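/- Let G be a dihedral group of order 2n, where n ≥ 3 is odd. Then the set of distances Δ(G) of the monoid of product-one sequences B(G) equals the integer interval [1, 2n−2]. -/

import Mathlib

namespace ProductOne

open scoped Classical

variable {G : Type*} [Group G]

/-- `S` is a product-one sequence over `G`: its terms can be ordered with product `1`. -/
def IsProductOne (S : Multiset G) : Prop :=
  ∃ l : List G, (l : Multiset G) = S ∧ l.prod = 1

/-- `S` is an atom (a minimal product-one sequence): it is a nontrivial product-one
sequence that is not the concatenation of two nontrivial product-one sequences. -/
def IsAtomSeq (S : Multiset G) : Prop :=
  S ≠ 0 ∧ IsProductOne S ∧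
    ∀ A B : Multiset G, S = A + B → IsProductOne A → IsProductOne B → A = 0 ∨ B = 0

/-- `S` is a sequence over the subset `G₀ ⊆ G`. -/
def SeqOn (G₀ : Set G) (S : Multiset G) : Prop := ∀ g ∈ S, g ∈ G₀

/-- `S` is an atom of the monoid `B(G₀)` of product-one sequences over `G₀`. -/
def IsAtomSeqOn (G₀ : Set G) (S : Multiset G) : Prop := SeqOn G₀ S ∧ IsAtomSeq S

/-- The set of lengths `L(A)` of factorizations of `A` into atoms over `G₀`. -/
def lengthsOn (G₀ : Set G) (A : Multiset G) : Set ℕ :=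
  {k | ∃ f : Multiset (Multiset G), Multiset.card f = k ∧
        (∀ U ∈ f, IsAtomSeqOn G₀ U) ∧ f.sum = A}

/-- The set of lengths `L(A)` over the whole group. -/
def lengths (A : Multiset G) : Set ℕ := lengthsOn Set.univ A

/-- The set of distances of a set `L ⊆ ℕ`. -/
def distancesOf (L : Set ℕ) : Set ℕ :=
  {d | 0 < d ∧ ∃ a, a ∈ L ∧ a + d ∈ L ∧ ∀ b ∈ L, ¬(a < b ∧ b < a + d)}

/-- The set of distances `Δ(G₀)` of the monoid `B(G₀)`. -/
def DeltaOn (G₀ : Set G) : Set ℕ :=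
  {d | ∃ A : Multiset G, SeqOn G₀ A ∧ IsProductOne A ∧ d ∈ distancesOf (lengthsOn G₀ A)}

/-- The set of distances `Δ(G)` of `B(G)`. -/
def Delta (G : Type*) [Group G] : Set ℕ := DeltaOn (Set.univ : Set G)

/-- The large Davenport constant of `G₀`: maximal length of an atom of `B(G₀)`. -/
noncomputable def DavenportOn (G₀ : Set G) : ℕ :=
  sSup {k | ∃ S : Multiset G, IsAtomSeqOn G₀ S ∧ Multiset.card S = k}

/-- The large Davenport constant `D(G)`. -/
noncomputable def Davenport (G : Type*) [Group G] : ℕ :=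
  DavenportOn (Set.univ : Set G)

/-- The small Davenport constant `d(G₀)`: maximal length of a product-one free
sequence over `G₀`. -/
noncomputable def smallDavenportOn (G₀ : Set G) : ℕ :=
  sSup {k | ∃ S : Multiset G, SeqOn G₀ S ∧ Multiset.card S = k ∧
        ∀ T : Multiset G, T ≤ S → T ≠ 0 → ¬IsProductOne T}

/-- `Δ*(G) = {min Δ(G₀) : G₀ ⊆ G with Δ(G₀) ≠ ∅}`. -/
def DeltaStar (G : Type*) [Group G] : Set ℕ :=
  {d | ∃ G₀ : Set G, (DeltaOn G₀).Nonempty ∧ d = sInf (DeltaOn G₀)}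

/-- The elasticity `ρ(L) = max L / min L` of a set of lengths (with the set of
positive elements used, and `ρ = 1` if there are none). -/
noncomputable def elasticity (L : Set ℕ) : ℚ :=
  if (L ∩ {k | 0 < k}).Nonempty then
    ((sSup (L ∩ {k | 0 < k}) : ℕ) : ℚ) / ((sInf (L ∩ {k | 0 < k}) : ℕ) : ℚ)
  else 1

/-- The elasticity `ρ(G₀)` of the monoid `B(G₀)`. -/
noncomputable def rhoOn (G₀ : Set G) : ℝ :=
  sSup {x : ℝ | ∃ A : Multiset G, SeqOn G₀ A ∧ IsProductOne A ∧
    x = (elasticity (lengthsOn G₀ A) : ℝ)}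

/-- `Δ*_ρ(G) = {min Δ(G₀) : G₀ ⊆ G with ρ(G₀) = D(G)/2}`. -/
noncomputable def DeltaRhoStar (G : Type*) [Group G] : Set ℕ :=
  {d | ∃ G₀ : Set G, rhoOn G₀ = (Davenport G : ℝ) / 2 ∧ d = sInf (DeltaOn G₀)}

/-- Divisibility in the monoid `B(G)`. -/
def BDvd (A S : Multiset G) : Prop :=
  ∃ C : Multiset G, IsProductOne C ∧ S = A + C

/-- The `ω`-invariant `ω(B(G), A)`. -/
noncomputable def omegaAt (A : Multiset G) : ℕ∞ :=
  sInf {N : ℕ∞ | ∀ f : Multiset (Multiset G),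
    (∀ B ∈ f, IsProductOne B) → BDvd A f.sum →
    ∃ t ≤ f, (Multiset.card t : ℕ∞) ≤ N ∧ BDvd A t.sum}

/-- `ω(G) = sup {ω(B(G), U) : U an atom of B(G)}`. -/
noncomputable def omegaInv (G : Type*) [Group G] : ℕ∞ :=
  ⨆ U ∈ {U : Multiset G | IsAtomSeq U}, omegaAt U

/-- `z` is a factorization of `A` into atoms. -/
def IsFactorization (A : Multiset G) (z : Multiset (Multiset G)) : Prop :=
  (∀ U ∈ z, IsAtomSeq U) ∧ z.sum = A

/-- The distance between two factorizations. -/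
noncomputable def factDist (z z' : Multiset (Multiset G)) : ℕ :=
  letI := Classical.decEq (Multiset G)
  max (Multiset.card (z - z')) (Multiset.card (z' - z))

/-- The catenary degree `c(A)`. -/
noncomputable def catenaryAt (A : Multiset G) : ℕ∞ :=
  sInf {N : ℕ∞ | ∀ z z' : Multiset (Multiset G),
    IsFactorization A z → IsFactorization A z' →
    Relation.ReflTransGen
      (fun x y => IsFactorization A y ∧ (factDist x y : ℕ∞) ≤ N) z z'}

/-- The set of positive catenary degrees `Ca(G)`. -/
noncomputable def CatenarySet (G : Type*) [Group G] : Set ℕ∞ :=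
  {c | ∃ A : Multiset G, IsProductOne A ∧ catenaryAt A = c ∧ 0 < c}

/-- The catenary degree `c(G)` of `B(G)`. -/
noncomputable def catenaryDegree (G : Type*) [Group G] : ℕ∞ :=
  ⨆ A ∈ {A : Multiset G | IsProductOne A}, catenaryAt A

/-- The cross number `k(S)` of a sequence. -/
noncomputable def crossNumber (S : Multiset G) : ℚ :=
  (S.map fun g => (1 : ℚ) / (orderOf g : ℚ)).sum

/-- The system of sets of lengths `L(G)`. -/
def LSystem (G : Type*) [Group G] : Set (Set ℕ) :=
  {L | ∃ A : Multiset G, IsProductOne A ∧ L = lengths A}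

/-- The set of products `π(S)` of all orderings of the terms of `S`. -/
def piSet (S : Multiset G) : Set G :=
  {g | ∃ l : List G, (l : Multiset G) = S ∧ l.prod = g}

/-- The sumset `{x₁, -x₁} + ⋯ + {x_s, -x_s}` for a sequence `a = x₁ ⋯ x_s`. -/
def signedSums {α : Type*} [AddCommGroup α] (a : Multiset α) : Set α :=
  {z | ∃ t ≤ a, z = t.sum + t.sum - a.sum}

/-- `Σ_k(T)`: the set of sums of `k`-term subsequences of `T`. -/
def subseqSums {α : Type*} [AddCommMonoid α] (k : ℕ) (T : Multiset α) : Set α :=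
  {z | ∃ t ≤ T, Multiset.card t = k ∧ t.sum = z}

/-- The subsequence `S_X` of all terms of `S` lying in `X`. -/
noncomputable def restrictTo (X : Set G) (S : Multiset G) : Multiset G :=
  letI := Classical.decPred fun g => g ∈ X
  S.filter fun g => g ∈ X

/-- The maximum multiplicity `h(S)` of a term of `S`. -/
noncomputable def maxMultiplicity {α : Type*} (S : Multiset α) : ℕ :=
  letI := Classical.decEq α
  S.toFinset.sup S.count

end ProductOne

namespace ProductOne

section Multisets

variable {α β : Type*}

/-- Riesz refinement for multisets. -/
theorem exists_refinement {Y Z E F : Multiset α} (h : Y + Z = E + F) :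
    ∃ YE YF ZE ZF : Multiset α, YE + YF = Y ∧ ZE + ZF = Z ∧ YE + ZE = E ∧ YF + ZF = F := by
  classical
  refine ⟨Y ∩ E, Y - E, E - Y, Z - (E - Y), ?_, ?_, ?_, ?_⟩ <;>
  · ext a
    have := congrArg (Multiset.count a) h
    simp only [Multiset.count_add, Multiset.count_inter, Multiset.count_sub] at this ⊢
    omega

theorem exists_add_of_map_eq_add {f : α → β} {s : Multiset α} {t u : Multiset β}
    (h : s.map f = t + u) : ∃ t' u' : Multiset α, s = t' + u' ∧ t'.map f = t ∧ u'.map f = u := by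
  classical
  induction t using Multiset.induction_on generalizing s with
  | empty => exact ⟨0, s, by simp, by simp, by simpa using h⟩
  | cons b t ih =>
    rw [Multiset.cons_add, ← Multiset.map_eq_cons] at h
    obtain ⟨a, ha, rfl, h⟩ := h
    obtain ⟨t', u', h1, rfl, rfl⟩ := ih h
    refine ⟨a ::ₘ t', u', ?_, by simp, rfl⟩
    rw [Multiset.cons_add, ← h1, Multiset.cons_erase ha]

/-- A submultiset of a sum of multisets is distributed over the summands. -/
theorem exists_distribution (g : Multiset (Multiset α)) {U C : Multiset α} (h : g.sum = U + C) :
    ∃ p : Multiset (Multiset α × Multiset α),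
      p.map (fun x => x.1 + x.2) = g ∧ (p.map Prod.fst).sum = U ∧ (p.map Prod.snd).sum = C := by
  induction g using Multiset.induction_on generalizing U C with
  | empty =>
    have h' : U + C = 0 := by simpa using h.symm
    rw [add_eq_zero] at h'
    exact ⟨0, by simp, by simp [h'.1], by simp [h'.2]⟩
  | cons V g ih =>
    rw [Multiset.sum_cons] at h
    obtain ⟨VU, VC, gU, gC, rfl, hg, rfl, rfl⟩ := exists_refinement h
    obtain ⟨p, rfl, rfl, rfl⟩ := ih hg.symm
    exact ⟨(VU, VC) ::ₘ p, by simp, by simp, by simp⟩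

theorem exists_list_map_eq {f : α → β} (l : List β) {s : Multiset α}
    (h : s.map f = (l : Multiset β)) : ∃ l' : List α, (l' : Multiset α) = s ∧ l'.map f = l := by
  classical
  induction l generalizing s with
  | nil => exact ⟨[], by simpa [eq_comm] using h, rfl⟩
  | cons b l ih =>
    rw [← Multiset.cons_coe, ← Multiset.map_eq_cons] at h
    obtain ⟨a, ha, rfl, h⟩ := h
    obtain ⟨l', h1, rfl⟩ := ih h
    exact ⟨a :: l', by rw [← Multiset.cons_coe, h1, Multiset.cons_erase ha], rfl⟩

theorem exists_add_card_eq {s : Multiset α} {k : ℕ} (h : k ≤ s.card) :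
    ∃ t u : Multiset α, s = t + u ∧ t.card = k := by
  obtain ⟨l, rfl⟩ := Quot.exists_rep s
  refine ⟨(l.take k : List α), (l.drop k : List α), ?_, ?_⟩
  · change (l : Multiset α) = _
    rw [Multiset.coe_add, List.take_append_drop]
  · have : k ≤ l.length := h
    simp [this]

end Multisets

section Group

variable {G : Type*} [Group G]

theorem isProductOne_zero : IsProductOne (0 : Multiset G) := ⟨[], rfl, rfl⟩

theorem IsProductOne.add {A B : Multiset G} (hA : IsProductOne A) (hB : IsProductOne B) :
    IsProductOne (A + B) := by
  obtain ⟨l, rfl, hl⟩ := hA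
  obtain ⟨m, rfl, hm⟩ := hB
  exact ⟨l ++ m, by simp, by simp [hl, hm]⟩

theorem isProductOne_sum {f : Multiset (Multiset G)} (h : ∀ U ∈ f, IsProductOne U) :
    IsProductOne f.sum := by
  induction f using Multiset.induction_on with
  | empty => simpa using isProductOne_zero
  | cons U f ih =>
    rw [Multiset.sum_cons]
    exact (h U (by simp)).add (ih fun V hV => h V (by simp [hV]))

theorem IsAtomSeq.isProductOne {U : Multiset G} (h : IsAtomSeq U) : IsProductOne U := h.2.1

theorem IsAtomSeq.card_pos {U : Multiset G} (h : IsAtomSeq U) : 0 < U.card :=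
  Multiset.card_pos.2 h.1

theorem IsProductOne.exists_atoms {A : Multiset G} (hA : IsProductOne A) :
    ∃ f : Multiset (Multiset G), (∀ U ∈ f, IsAtomSeq U) ∧ f.sum = A := by
  induction hk : A.card using Nat.strong_induction_on generalizing A with
  | _ k ih =>
    by_cases h0 : A = 0
    · exact ⟨0, by simp, by simp [h0]⟩
    by_cases hat : IsAtomSeq A
    · exact ⟨{A}, by simpa using hat, by simp⟩
    · simp only [IsAtomSeq, not_and, not_forall, not_or] at hat
      obtain ⟨B, C, rfl, hB, hC, hB0, hC0⟩ := hat h0 hA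
      have h1 := Multiset.card_pos.2 hB0
      have h2 := Multiset.card_pos.2 hC0
      rw [Multiset.card_add] at hk
      obtain ⟨f, hf, rfl⟩ := ih B.card (by omega) hB rfl
      obtain ⟨g, hg, rfl⟩ := ih C.card (by omega) hC rfl
      refine ⟨f + g, fun U hU => ?_, by simp⟩
      rcases Multiset.mem_add.1 hU with h | h
      exacts [hf U h, hg U h]

/-- A factorization of an atom is trivial. -/
theorem eq_singleton_of_sum_eq_atom {f : Multiset (Multiset G)} (hf : ∀ U ∈ f, IsAtomSeq U)
    {T : Multiset G} (hT : IsAtomSeq T) (h : f.sum = T) : f = {T} := by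
  induction f using Multiset.induction_on with
  | empty => exact absurd (by simpa using h.symm) hT.1
  | cons U f _ =>
    rw [Multiset.sum_cons] at h
    have hU := hf U (by simp)
    have hf' : ∀ V ∈ f, IsAtomSeq V := fun V hV => hf V (by simp [hV])
    rcases hT.2.2 U f.sum h.symm hU.isProductOne
      (isProductOne_sum fun V hV => (hf' V hV).isProductOne) with h0 | h0
    · exact absurd h0 hU.1
    · have : f = 0 := by
        rcases Multiset.empty_or_exists_mem f with h1 | ⟨V, hV⟩
        · exact h1
        · have := Multiset.single_le_sum (fun _ _ => zero_le) V hV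
          rw [h0] at this
          exact absurd (le_antisymm this zero_le) (hf' V hV).1
      subst this
      simp_all

theorem isAtomSeq_singleton_one : IsAtomSeq ({1} : Multiset G) := by
  refine ⟨by simp, ⟨[1], rfl, by simp⟩, fun A B h _ _ => ?_⟩
  have := congrArg Multiset.card h
  simp only [Multiset.card_singleton, Multiset.card_add] at this
  rw [← Multiset.card_eq_zero, ← Multiset.card_eq_zero]
  omega

theorem IsAtomSeq.eq_singleton_one {U : Multiset G} (hU : IsAtomSeq U) (h : (1 : G) ∈ U) :
    U = {1} := by
  obtain ⟨l, hl, hprod⟩ := hU.isProductOne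
  subst hl
  obtain ⟨s, t, rfl⟩ := List.append_of_mem (Multiset.mem_coe.1 h)
  have hrest : IsProductOne ((s ++ t : List G) : Multiset G) := ⟨_, rfl, by simpa using hprod⟩
  have heq : ((s ++ 1 :: t : List G) : Multiset G) = {1} + ((s ++ t : List G) : Multiset G) := by
    rw [Multiset.singleton_add, Multiset.cons_coe, Multiset.coe_eq_coe]
    exact List.perm_middle
  rcases hU.2.2 _ _ heq isAtomSeq_singleton_one.isProductOne hrest with h0 | h0
  · simp at h0
  · rw [heq, h0, add_zero]

theorem IsAtomSeq.two_le_card {U : Multiset G} (hU : IsAtomSeq U) (h : (1 : G) ∉ U) :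
    2 ≤ U.card := by
  by_contra hlt
  have := hU.card_pos
  obtain ⟨g, rfl⟩ := Multiset.card_eq_one.1 (show U.card = 1 by omega)
  obtain ⟨l, hl, hprod⟩ := hU.isProductOne
  rw [Multiset.coe_eq_singleton] at hl
  subst hl
  simp_all

/-- The length of an atom is at most the order of the group. -/
theorem IsAtomSeq.card_le [Finite G] {U : Multiset G} (hU : IsAtomSeq U) :
    U.card ≤ Nat.card G := by
  have := Fintype.ofFinite G
  by_contra hlt
  obtain ⟨l, rfl, hprod⟩ := hU.isProductOne
  rw [Multiset.coe_card, not_le, Nat.card_eq_fintype_card] at hlt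
  obtain ⟨i, j, hij, h⟩ := Fintype.exists_ne_map_eq_of_card_lt
    (fun i : Fin l.length => (l.take i).prod) (by simpa using hlt)
  wlog hlt' : i < j generalizing i j
  · exact this j i hij.symm h.symm (lt_of_le_of_ne (not_lt.1 hlt') hij.symm)
  have hi := i.2
  have hj := j.2
  have hij' : (i : ℕ) < j := hlt'
  set a := l.take i
  set b := (l.drop i).take (j - i)
  set c := l.drop j
  have hab : l.take j = a ++ b := by
    have : (j : ℕ) = i + (j - i) := by omega
    conv_lhs => rw [this, List.take_add]
  have hl : l = a ++ b ++ c := by rw [← hab, List.take_append_drop]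
  have hb : b.prod = 1 := by
    rw [hab, List.prod_append] at h
    simpa [a] using h.symm
  have hac : (a ++ c).prod = 1 := by
    rw [hl] at hprod
    simpa [hb] using hprod
  have hsum : (l : Multiset G) = (b : Multiset G) + ((a ++ c : List G) : Multiset G) := by
    conv_lhs => rw [hl]
    simp only [← Multiset.coe_add]
    abel
  have hbl : b.length = j - i := by simp [b]
  rcases hU.2.2 _ _ hsum ⟨_, rfl, hb⟩ ⟨_, rfl, hac⟩ with h0 | h0
  · have := congrArg Multiset.card h0
    simp at this
    simp [this] at hbl
    omega
  · have := congrArg Multiset.card h0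
    have hcl : c.length = l.length - j := by simp [c]
    simp at this
    simp [this.2] at hcl
    omega

/-- If each `u ::ₘ W` and the sequence of the `u` are product-one, so is the sum of the `W`. -/
theorem isProductOne_sum_snd {h : Multiset (G × Multiset G)}
    (hp : ∀ x ∈ h, IsProductOne (x.1 ::ₘ x.2)) (hu : IsProductOne (h.map Prod.fst)) :
    IsProductOne (h.map Prod.snd).sum := by
  obtain ⟨l, hl, hprod⟩ := hu
  obtain ⟨l', rfl, rfl⟩ := exists_list_map_eq l hl.symm
  suffices H : ∀ m : List (G × Multiset G), (∀ x ∈ m, IsProductOne (x.1 ::ₘ x.2)) →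
      ∃ w : List G, (w : Multiset G) = (m.map Prod.snd).sum ∧ w.prod = (m.map Prod.fst).prod⁻¹ by
    obtain ⟨w, hw, hw'⟩ := H l' (fun x hx => hp x (by simpa using hx))
    exact ⟨w, by simpa using hw, by rw [hw', hprod, inv_one]⟩
  intro m
  induction m with
  | nil => exact fun _ => ⟨[], by simp, by simp⟩
  | cons x m ih =>
    intro hm
    obtain ⟨w, hw, hw'⟩ := ih fun y hy => hm y (by simp [hy])
    obtain ⟨v, hv, hv'⟩ := hm x (by simp)
    have hx : x.1 ∈ v := by rw [← Multiset.mem_coe, hv]; simp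
    obtain ⟨s, t, rfl⟩ := List.append_of_mem hx
    refine ⟨w ++ (t ++ s), ?_, ?_⟩
    · have h2 : ((s ++ x.1 :: t : List G) : Multiset G) =
          x.1 ::ₘ ((t ++ s : List G) : Multiset G) := by
        rw [Multiset.cons_coe, Multiset.coe_eq_coe]
        exact List.perm_middle.trans (List.Perm.cons _ List.perm_append_comm)
      rw [h2, Multiset.cons_inj_right] at hv
      rw [← Multiset.coe_add, hv, hw]
      simp [add_comm]
    · simp only [List.prod_append, List.prod_cons, List.map_cons, mul_inv_rev] at hv' ⊢
      rw [hw']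
      congr 1
      have h3 : s.prod * x.1 * t.prod = 1 := by rw [mul_assoc]; exact hv'
      have h4 : s.prod * x.1 = t.prod⁻¹ := eq_inv_of_mul_eq_one_left h3
      have h5 : s.prod = t.prod⁻¹ * x.1⁻¹ := by rw [← h4]; group
      rw [h5]; group

theorem mem_lengthsOn_univ {A : Multiset G} {k : ℕ} :
    k ∈ lengthsOn Set.univ A ↔ ∃ f : Multiset (Multiset G), f.card = k ∧
      (∀ U ∈ f, IsAtomSeq U) ∧ f.sum = A := by
  simp [lengthsOn, IsAtomSeqOn, SeqOn]

end Group

end ProductOne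

namespace ProductOne

section Additive

variable {α H : Type*} [AddCommGroup H]

theorem exists_maximal_part (P : Multiset α → Prop) (h0 : P 0) (M : Multiset α) :
    ∃ I J, M = I + J ∧ P I ∧ ∀ i ∈ J, ¬ P (i ::ₘ I) := by
  suffices ∀ J I, P I → ∃ I' J', I + J = I' + J' ∧ P I' ∧ ∀ i ∈ J', ¬ P (i ::ₘ I') by
    simpa using this M 0 h0
  intro J
  induction J using Multiset.strongInductionOn with
  | _ J ih =>
    intro I hI
    by_cases h : ∃ i ∈ J, P (i ::ₘ I)
    · obtain ⟨i, hi, hP⟩ := h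
      obtain ⟨J, rfl⟩ := Multiset.exists_cons_of_mem hi
      obtain ⟨I', J', h1, h2⟩ := ih J (Multiset.lt_cons_self J i) _ hP
      exact ⟨I', J', by rw [← h1]; simp, h2⟩
    · push Not at h
      exact ⟨I, J, rfl, hI, h⟩

/-- The set of sums of subfamilies of the family `M` weighted by `x`. -/
def subsums (x : α → H) (M : Multiset α) : Set H := {h | ∃ t ≤ M, (t.map x).sum = h}

/-- `X` is closed under translation by `g`. -/
def Stable (X : Set H) (g : H) : Prop := ∀ y ∈ X, y + g ∈ X

variable {x : α → H} {M N : Multiset α}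

theorem zero_mem_subsums : (0 : H) ∈ subsums x M := ⟨0, zero_le, by simp⟩

theorem subsums_mono (h : M ≤ N) : subsums x M ⊆ subsums x N :=
  fun _ ⟨t, ht, hs⟩ => ⟨t, ht.trans h, hs⟩

theorem add_mem_subsums_add {a b : H} (ha : a ∈ subsums x M) (hb : b ∈ subsums x N) :
    a + b ∈ subsums x (M + N) := by
  obtain ⟨t, ht, rfl⟩ := ha
  obtain ⟨u, hu, rfl⟩ := hb
  exact ⟨t + u, add_le_add ht hu, by simp⟩

theorem mem_subsums_add {a : H} :
    a ∈ subsums x (M + N) ↔ ∃ b ∈ subsums x M, ∃ c ∈ subsums x N, b + c = a := by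
  constructor
  · rintro ⟨t, ht, rfl⟩
    obtain ⟨u, hu⟩ := Multiset.le_iff_exists_add.1 ht
    obtain ⟨tM, uM, tN, uN, rfl, rfl, rfl, rfl⟩ :=
      exists_refinement hu
    exact ⟨_, ⟨tM, Multiset.le_add_right _ _, rfl⟩, _,
      ⟨tN, Multiset.le_add_right _ _, rfl⟩, by simp⟩
  · rintro ⟨b, hb, c, hc, rfl⟩
    exact add_mem_subsums_add hb hc

theorem mem_subsums_singleton {a : H} {i : α} : a ∈ subsums x {i} ↔ a = 0 ∨ a = x i := by
  constructor
  · rintro ⟨t, ht, rfl⟩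
    rcases Multiset.le_singleton.1 ht with rfl | rfl <;> simp
  · rintro (rfl | rfl)
    exacts [zero_mem_subsums, ⟨{i}, le_rfl, by simp⟩]

theorem Stable.add {X : Set H} {g h : H} (hg : Stable X g) (hh : Stable X h) :
    Stable X (g + h) := fun y hy => by
  rw [← add_assoc]; exact hh _ (hg _ hy)

theorem stable_zero (X : Set H) : Stable X 0 := fun y hy => by simpa using hy

theorem Stable.nsmul {X : Set H} {g : H} (hg : Stable X g) (k : ℕ) : Stable X (k • g) := by
  induction k with
  | zero => simpa using stable_zero X
  | succ k ih => rw [succ_nsmul]; exact ih.add hg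

theorem Stable.neg [Finite H] {X : Set H} {g : H} (hg : Stable X g) : Stable X (-g) := by
  have h := hg.nsmul (addOrderOf g - 1)
  have h1 : (addOrderOf g - 1) • g = -g := by
    rw [eq_neg_iff_add_eq_zero, ← succ_nsmul, Nat.sub_add_cancel (addOrderOf_pos g),
      addOrderOf_nsmul_eq_zero]
  rwa [h1] at h

theorem Stable.multiset_sum {X : Set H} {t : Multiset α} (h : ∀ i ∈ t, Stable X (x i)) :
    Stable X (t.map x).sum := by
  induction t using Multiset.induction_on with
  | empty => simpa using stable_zero X
  | cons i t ih =>
    rw [Multiset.map_cons, Multiset.sum_cons]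
    exact (h i (by simp)).add (ih fun j hj => h j (by simp [hj]))

theorem Stable.subsums_mono {g : H} (h : Stable (subsums x M) g) (hMN : M ≤ N) :
    Stable (subsums x N) g := by
  obtain ⟨K, rfl⟩ := Multiset.le_iff_exists_add.1 hMN
  intro y hy
  obtain ⟨b, hb, c, hc, rfl⟩ := mem_subsums_add.1 hy
  rw [add_right_comm]
  exact add_mem_subsums_add (h b hb) hc

/-- Adding further members by which the set of subsums is stable does not enlarge it. -/
theorem subsums_add_eq (h : ∀ i ∈ N, Stable (subsums x M) (x i)) :
    subsums x (M + N) = subsums x M := by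
  refine Set.Subset.antisymm (fun y hy => ?_) (subsums_mono (Multiset.le_add_right M N))
  obtain ⟨b, hb, c, ⟨t, ht, rfl⟩, rfl⟩ := mem_subsums_add.1 hy
  exact Stable.multiset_sum (fun i hi => h i (Multiset.mem_of_le ht hi)) b hb

/-- Every family has a part with many subsums whose set of subsums is stable under the rest. -/
theorem exists_subsums_stable [Finite H] (x : α → H) (M : Multiset α) :
    ∃ I J, M = I + J ∧ I.card + 1 ≤ (subsums x I).ncard ∧
      ∀ i ∈ J, Stable (subsums x I) (x i) := by
  obtain ⟨I, J, hM, hI, hmax⟩ := exists_maximal_part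
    (fun I => I.card + 1 ≤ (subsums x I).ncard)
    (by
      change 0 + 1 ≤ _
      exact (Set.ncard_pos (Set.toFinite _)).2 ⟨0, zero_mem_subsums⟩) M
  refine ⟨I, J, hM, hI, fun i hi y hy => ?_⟩
  have h1 := hmax i hi
  rw [Multiset.card_cons] at h1
  have h2 : subsums x I ⊆ subsums x (i ::ₘ I) := subsums_mono (Multiset.le_cons_self I i)
  rw [Set.eq_of_subset_of_ncard_le h2 (by omega) (Set.toFinite _), ← Multiset.singleton_add,
    add_comm ({i} : Multiset α)]
  exact add_mem_subsums_add hy (mem_subsums_singleton.2 (Or.inr rfl))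

theorem card_lt_ncard_subsums_of_zeroFree [Finite H]
    (h : ∀ T ≤ M, (T.map x).sum = 0 → T = 0) : M.card + 1 ≤ (subsums x M).ncard := by
  obtain ⟨I, J, rfl, hI, hJ⟩ := exists_subsums_stable x M
  rcases Multiset.empty_or_exists_mem J with rfl | ⟨i, hi⟩
  · simpa using hI
  · exfalso
    obtain ⟨t, ht, hs⟩ := (hJ i hi).neg 0 zero_mem_subsums
    have := h (t + {i}) (add_le_add ht (Multiset.singleton_le.2 hi)) (by simp [hs])
    simp at this

theorem card_lt_ncard_subsums_or [Finite H] (x : α → H) (M : Multiset α) :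
    M.card + 1 ≤ (subsums x M).ncard ∨ ∃ i ∈ M, Stable (subsums x M) (x i) := by
  obtain ⟨I, J, rfl, hI, hJ⟩ := exists_subsums_stable x M
  rcases Multiset.empty_or_exists_mem J with rfl | ⟨i, hi⟩
  · left; simpa using hI
  · exact Or.inr ⟨i, by simp [hi], (hJ i hi).subsums_mono (Multiset.le_add_right I J)⟩

/-- The subgroup of periods of a subset of a finite abelian group. -/
def periods [Finite H] (X : Set H) : AddSubgroup H where
  carrier := {g | Stable X g}
  zero_mem' := stable_zero X
  add_mem' := Stable.add
  neg_mem' := Stable.neg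

theorem mem_periods [Finite H] {X : Set H} {g : H} : g ∈ periods X ↔ Stable X g := Iff.rfl

/-- A long family over a finite abelian group of odd order either has all subsums, or contains
a short zero-sum part that can be removed without affecting the periods it accounts for. -/
theorem subsums_eq_univ_or_exists_removable [Finite H] (hodd : Odd (Nat.card H)) (x : α → H)
    (M : Multiset α) (hM : Nat.card H ≤ M.card + 1) :
    subsums x M = Set.univ ∨ ∃ T C, M = T + C ∧ T ≠ 0 ∧ 3 * T.card ≤ Nat.card H ∧
      (T.map x).sum = 0 ∧ ∀ i ∈ T, Stable (subsums x C) (x i) := by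
  classical
  by_cases huniv : subsums x M = Set.univ
  · exact Or.inl huniv
  right
  set K := periods (subsums x M) with hK
  set A := M.filter (fun i => x i ∈ K) with hA
  set B := M.filter (fun i => ¬ x i ∈ K) with hB
  have hAB : A + B = M := Multiset.filter_add_not _ _
  have hABc : A.card + B.card = M.card := by rw [← hAB, Multiset.card_add]
  -- the index of the subgroup of periods
  have hcard : K.index * Nat.card K = Nat.card H := K.index_mul_card
  have hKtop : K ≠ ⊤ := by
    intro htop
    refine huniv (Set.eq_univ_of_forall fun y => ?_)
    have : y ∈ K := htop ▸ AddSubgroup.mem_top y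
    simpa using (mem_periods.1 this) 0 zero_mem_subsums
  have hq1 : K.index ≠ 1 := fun h => hKtop (AddSubgroup.index_eq_one.1 h)
  have hq0 : K.index ≠ 0 := AddSubgroup.index_ne_zero_of_finite
  have hqodd : Odd K.index := (Nat.odd_mul.1 (hcard ▸ hodd)).1
  have hq3 : 3 ≤ K.index := by
    obtain ⟨r, hr⟩ := hqodd
    omega
  -- few members lie outside the subgroup of periods
  have hBc : B.card + 2 ≤ K.index := by
    let xq : α → H ⧸ K := fun i => (x i : H ⧸ K)
    have himg : ∀ y : H, ((y : H ⧸ K) ∈ subsums xq B) → y ∈ subsums x M := by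
      rintro y ⟨t, ht, hs⟩
      have hs' : (((t.map x).sum : H) : H ⧸ K) = (y : H ⧸ K) := by
        rw [← hs]
        have := map_multiset_sum (QuotientAddGroup.mk' K) (t.map x)
        simpa [xq, Multiset.map_map, Function.comp_def] using this
      rw [QuotientAddGroup.eq] at hs'
      have hmem : (t.map x).sum ∈ subsums x M := ⟨t, ht.trans (Multiset.filter_le _ _), rfl⟩
      have := (mem_periods.1 hs') _ hmem
      simpa using this
    have himg' : ∀ y ∈ subsums x M, (y : H ⧸ K) ∈ subsums xq B := by
      intro y hy
      rw [← hAB] at hy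
      obtain ⟨b, ⟨t, ht, rfl⟩, c, ⟨u, hu, rfl⟩, rfl⟩ := mem_subsums_add.1 hy
      refine ⟨u, hu, ?_⟩
      have h1 : (t.map x).sum ∈ K := by
        refine K.multiset_sum_mem _ fun z hz => ?_
        obtain ⟨i, hi, rfl⟩ := Multiset.mem_map.1 hz
        exact (Multiset.mem_filter.1 (Multiset.mem_of_le ht hi)).2
      have h2 := map_multiset_sum (QuotientAddGroup.mk' K) (u.map x)
      have h3 : ((t.map x).sum : H ⧸ K) = 0 := (QuotientAddGroup.eq_zero_iff _).2 h1
      rw [QuotientAddGroup.mk_add, h3, zero_add]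
      simpa [xq, Multiset.map_map, Function.comp_def] using h2.symm
    have hne : subsums xq B ≠ Set.univ := by
      intro h
      refine huniv (Set.eq_univ_of_forall fun y => himg y ?_)
      rw [h]; trivial
    have hlt : (subsums xq B).ncard < K.index := by
      have h1 := Set.ncard_lt_card hne
      rwa [show Nat.card (H ⧸ K) = K.index from rfl] at h1
    rcases card_lt_ncard_subsums_or xq B with h | ⟨i, hi, hst⟩
    · omega
    · exfalso
      refine (Multiset.mem_filter.1 hi).2 (mem_periods.2 fun y hy => himg _ ?_)
      rw [QuotientAddGroup.mk_add]
      exact hst _ (himg' y hy)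
  have hAc : 2 * Nat.card K ≤ A.card + 1 := by
    have hpos : 0 < Nat.card K := Nat.card_pos
    obtain ⟨h', hh'⟩ : ∃ h', Nat.card K = h' + 1 := ⟨Nat.card K - 1, by omega⟩
    obtain ⟨q', hq'⟩ : ∃ q', K.index = q' + 3 := ⟨K.index - 3, by omega⟩
    rw [hh', hq'] at hcard
    rw [hh']
    rw [hq'] at hBc
    nlinarith
  have hsubK : ∀ N ≤ A, (subsums x N).ncard ≤ Nat.card K := by
    intro N hN
    have : subsums x N ⊆ (K : Set H) := by
      rintro y ⟨t, ht, rfl⟩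
      refine K.multiset_sum_mem _ fun z hz => ?_
      obtain ⟨i, hi, rfl⟩ := Multiset.mem_map.1 hz
      exact (Multiset.mem_filter.1 (Multiset.mem_of_le (ht.trans hN) hi)).2
    exact Set.ncard_le_ncard this (Set.toFinite _)
  obtain ⟨I, J, hIJ, hI, hJ⟩ := exists_subsums_stable x A
  have hIc := hsubK I (hIJ ▸ Multiset.le_add_right I J)
  have hJc : Nat.card K ≤ J.card := by
    have := congrArg Multiset.card hIJ
    rw [Multiset.card_add] at this
    omega
  obtain ⟨J₁, J₂, hJ12, hJ1⟩ := exists_add_card_eq hJc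
  have hJA : J₁ ≤ A := by
    rw [hIJ, hJ12]
    exact (Multiset.le_add_right _ _).trans (Multiset.le_add_left _ _)
  have hex : ∃ T ≤ J₁, (T.map x).sum = 0 ∧ T ≠ 0 := by
    by_contra hcon
    push Not at hcon
    have h1 := card_lt_ncard_subsums_of_zeroFree hcon
    have h2 := hsubK J₁ hJA
    omega
  obtain ⟨T, hT, hT0, hTne⟩ := hex
  obtain ⟨R, rfl⟩ := Multiset.le_iff_exists_add.1 hT
  refine ⟨T, I + R + J₂ + B, ?_, hTne, ?_, hT0, fun i hi => ?_⟩
  · rw [← hAB, hIJ, hJ12]; abel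
  · have h1 : T.card ≤ Nat.card K := by
      rw [← hJ1, Multiset.card_add]; omega
    rw [← hcard]
    exact Nat.mul_le_mul hq3 h1
  · refine (hJ i ?_).subsums_mono ?_
    · rw [hJ12]; simp [hi]
    · rw [add_assoc, add_assoc]; exact Multiset.le_add_right _ _

end Additive

end ProductOne

namespace ProductOne

section Selection

variable {α H : Type*} [AddCommGroup H]

/-- The sums obtained by choosing `0`, `e i` or `f i` for each member `i` of the family `M`. -/
def choiceSums (e f : α → H) (M : Multiset α) : Set H :=
  {h | ∃ A B C, M = A + B + C ∧ (B.map e).sum + (C.map f).sum = h}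

variable {e f : α → H}

theorem zero_mem_choiceSums {M : Multiset α} : (0 : H) ∈ choiceSums e f M :=
  ⟨M, 0, 0, by simp, by simp⟩

theorem choiceSums_cons_of_mem {M : Multiset α} {h : H} (hh : h ∈ choiceSums e f M) (i : α) :
    h ∈ choiceSums e f (i ::ₘ M) ∧ h + e i ∈ choiceSums e f (i ::ₘ M) ∧
      h + f i ∈ choiceSums e f (i ::ₘ M) := by
  obtain ⟨A, B, C, rfl, rfl⟩ := hh
  refine ⟨⟨i ::ₘ A, B, C, by simp, rfl⟩, ⟨A, i ::ₘ B, C, by simp, ?_⟩, ⟨A, B, i ::ₘ C, by simp, ?_⟩⟩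
  · rw [Multiset.map_cons, Multiset.sum_cons]; abel
  · rw [Multiset.map_cons, Multiset.sum_cons]; abel

theorem mem_choiceSums_cons {M : Multiset α} {h : H} {i : α} :
    h ∈ choiceSums e f (i ::ₘ M) ↔ h ∈ choiceSums e f M ∨
      (∃ y ∈ choiceSums e f M, h = y + e i) ∨ ∃ y ∈ choiceSums e f M, h = y + f i := by
  constructor
  · rintro ⟨A, B, C, hM, rfl⟩
    have hi : i ∈ A + B + C := by rw [← hM]; simp
    rcases Multiset.mem_add.1 hi with hi | hi
    · rcases Multiset.mem_add.1 hi with hi | hi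
      · obtain ⟨A, rfl⟩ := Multiset.exists_cons_of_mem hi
        exact Or.inl ⟨A, B, C, by simpa using hM, rfl⟩
      · obtain ⟨B, rfl⟩ := Multiset.exists_cons_of_mem hi
        refine Or.inr (Or.inl ⟨_, ⟨A, B, C, by simpa using hM, rfl⟩, ?_⟩)
        rw [Multiset.map_cons, Multiset.sum_cons]; abel
    · obtain ⟨C, rfl⟩ := Multiset.exists_cons_of_mem hi
      refine Or.inr (Or.inr ⟨_, ⟨A, B, C, by simpa using hM, rfl⟩, ?_⟩)
      rw [Multiset.map_cons, Multiset.sum_cons]; abel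
  · rintro (h | ⟨y, h, rfl⟩ | ⟨y, h, rfl⟩)
    exacts [(choiceSums_cons_of_mem h i).1, (choiceSums_cons_of_mem h i).2.1,
      (choiceSums_cons_of_mem h i).2.2]

variable [Finite H]

theorem Stable.mem_iff {X : Set H} {g : H} (hg : Stable X g) {y : H} : y + g ∈ X ↔ y ∈ X :=
  ⟨fun h => by simpa using hg.neg _ h, hg y⟩

theorem exists_period_of_ncard_eq {X X' : Set H} {u v : H} (hu : u ≠ 0) (hv : v ≠ 0) (huv : u ≠ v)
    (hX' : ∀ h, h ∈ X' ↔ h ∈ X ∨ (∃ y ∈ X, h = y + u) ∨ ∃ y ∈ X, h = y + v)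
    (hcard : X'.ncard ≤ X.ncard + 1) (hns : ¬ Stable X u) : ∃ g ≠ 0, Stable X' g := by
  by_cases hvs : Stable X v
  · refine ⟨v, hv, fun z hz => ?_⟩
    rw [hX'] at hz ⊢
    rcases hz with h | ⟨y, h, rfl⟩ | ⟨y, h, rfl⟩
    · exact Or.inl (hvs _ h)
    · exact Or.inr (Or.inl ⟨y + v, hvs _ h, by abel⟩)
    · exact Or.inl (hvs _ (hvs _ h))
  · have hsub : X ⊆ X' := fun y hy => (hX' y).2 (Or.inl hy)
    have huniq : ∀ y ∈ X', y ∉ X → ∀ z ∈ X', z ∉ X → y = z := by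
      intro y hy hyX z hz hzX
      by_contra hyz
      have h1 : (insert y (insert z X)).ncard ≤ X'.ncard :=
        Set.ncard_le_ncard (Set.insert_subset hy (Set.insert_subset hz hsub)) (Set.toFinite _)
      rw [Set.ncard_insert_of_notMem (by simp [hyz, hyX]) (Set.toFinite _),
        Set.ncard_insert_of_notMem hzX (Set.toFinite _)] at h1
      omega
    simp only [Stable, not_forall] at hns hvs
    obtain ⟨y₁, hy₁, hy₁u⟩ := hns
    obtain ⟨y₂, hy₂, hy₂v⟩ := hvs
    have hm₁ : y₁ + u ∈ X' := (hX' _).2 (Or.inr (Or.inl ⟨y₁, hy₁, rfl⟩))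
    have hm₂ : y₂ + v ∈ X' := (hX' _).2 (Or.inr (Or.inr ⟨y₂, hy₂, rfl⟩))
    refine ⟨u, hu, fun z hz => ?_⟩
    by_cases hzX : z ∈ X
    · exact (hX' _).2 (Or.inr (Or.inl ⟨z, hzX, rfl⟩))
    · have hz2 : z = y₂ + v := huniq z hz hzX _ hm₂ hy₂v
      have hy2u : y₂ + u ∈ X' := (hX' _).2 (Or.inr (Or.inl ⟨y₂, hy₂, rfl⟩))
      by_cases hin : y₂ + u ∈ X
      · exact (hX' _).2 (Or.inr (Or.inr ⟨_, hin, by rw [hz2]; abel⟩))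
      · exact absurd (add_left_cancel (huniq _ hy2u hin _ hm₂ hy₂v)) huv

/-- A sum of the `e i` can be realized by choices of total cost at most the order of the group,
if each member costs at most one, or costs two and offers two distinct nonzero choices. -/
theorem exists_cheap_choice (e f : α → H) (c : α → ℕ) (M : Multiset α)
    (hc : ∀ i ∈ M, c i ≤ 1 ∨ (c i ≤ 2 ∧ e i ≠ 0 ∧ f i ≠ 0 ∧ e i ≠ f i)) :
    ∃ A B C, M = A + B + C ∧ (B.map e).sum + (C.map f).sum = (M.map e).sum ∧
      ((B + C).map c).sum ≤ Nat.card H := by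
  obtain ⟨I, J, hM, hI, hmax⟩ := exists_maximal_part
    (fun I => (I.map c).sum + 1 ≤ (choiceSums e f I).ncard ∨
      ((I.map c).sum ≤ (choiceSums e f I).ncard ∧ ∃ g ≠ 0, Stable (choiceSums e f I) g))
    (by
      left
      simp only [Multiset.map_zero, Multiset.sum_zero]
      exact (Set.ncard_pos (Set.toFinite _)).2 ⟨0, zero_mem_choiceSums⟩) M
  have hstable : ∀ i ∈ J, Stable (choiceSums e f I) (e i) := by
    intro i hi
    by_contra hns
    apply hmax i hi
    set X := choiceSums e f I with hX
    set X' := choiceSums e f (i ::ₘ I) with hX'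
    have hmem : ∀ h, h ∈ X' ↔ h ∈ X ∨ (∃ y ∈ X, h = y + e i) ∨ ∃ y ∈ X, h = y + f i :=
      fun h => mem_choiceSums_cons
    have hsub : X ⊆ X' := fun y hy => (hmem y).2 (Or.inl hy)
    obtain ⟨y, hy⟩ : ∃ y ∈ X, y + e i ∉ X := by simpa [Stable] using hns
    have hyX' : y + e i ∈ X' := (hmem _).2 (Or.inr (Or.inl ⟨y, hy.1, rfl⟩))
    have hlt : X.ncard + 1 ≤ X'.ncard := by
      rw [← Set.ncard_insert_of_notMem hy.2 (Set.toFinite _)]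
      exact Set.ncard_le_ncard (Set.insert_subset hyX' hsub) (Set.toFinite _)
    rw [Multiset.map_cons, Multiset.sum_cons]
    have hper : ∀ g, Stable X g → Stable X' g := by
      intro g hg z hz
      rw [hmem] at hz ⊢
      rcases hz with h | ⟨y, h, rfl⟩ | ⟨y, h, rfl⟩
      · exact Or.inl (hg _ h)
      · exact Or.inr (Or.inl ⟨y + g, hg _ h, by abel⟩)
      · exact Or.inr (Or.inr ⟨y + g, hg _ h, by abel⟩)
    rcases hc i (by rw [hM]; simp [hi]) with h1 | ⟨h2, he, hf, hef⟩
    · rcases hI with hI | ⟨hI, g, hg0, hg⟩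
      · left; omega
      · exact Or.inr ⟨by omega, g, hg0, hper g hg⟩
    · rcases hI with hI | ⟨hI, g, hg0, hg⟩
      · by_cases hbig : X.ncard + 2 ≤ X'.ncard
        · left; omega
        · exact Or.inr ⟨by omega,
            exists_period_of_ncard_eq he hf hef hmem (by omega) hns⟩
      · right
        refine ⟨?_, g, hg0, hper g hg⟩
        have h3 : y + e i + g ∈ X' := hper g hg _ hyX'
        have h4 : y + e i + g ∉ X := fun h => hy.2 (hg.mem_iff.1 h)
        have h5 : (insert (y + e i + g) (insert (y + e i) X)).ncard ≤ X'.ncard :=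
          Set.ncard_le_ncard (Set.insert_subset h3 (Set.insert_subset hyX' hsub)) (Set.toFinite _)
        rw [Set.ncard_insert_of_notMem (by simp [hg0, h4]) (Set.toFinite _),
          Set.ncard_insert_of_notMem hy.2 (Set.toFinite _)] at h5
        omega
  have htarget : (M.map e).sum ∈ choiceSums e f I := by
    have h1 : (I.map e).sum ∈ choiceSums e f I := ⟨0, I, 0, by simp, by simp⟩
    have := Stable.multiset_sum hstable _ h1
    rwa [hM, Multiset.map_add, Multiset.sum_add]
  obtain ⟨A, B, C, rfl, hsum⟩ := htarget
  refine ⟨A + J, B, C, by rw [hM]; abel, hsum, ?_⟩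
  have hle : (choiceSums e f (A + B + C)).ncard ≤ Nat.card H := Set.ncard_le_card _
  have hcost : ((A + B + C).map c).sum = (A.map c).sum + ((B + C).map c).sum := by
    simp [add_assoc]
  rcases hI with hI | ⟨hI, -⟩ <;> omega

end Selection

end ProductOne

namespace ProductOne

open DihedralGroup

section Dihedral

variable {n : ℕ}

/-- The number of reflections in a sequence over a dihedral group. -/
def nref : Multiset (DihedralGroup n) →+ ℕ :=
  Multiset.sumAddMonoidHom.comp
    (Multiset.mapAddMonoidHom fun g => match g with | r _ => 0 | sr _ => 1)

/-- The sum of the indices of the terms of a sequence over a dihedral group. -/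
def idxSum : Multiset (DihedralGroup n) →+ ZMod n :=
  Multiset.sumAddMonoidHom.comp
    (Multiset.mapAddMonoidHom fun g => match g with | r i => i | sr i => i)

@[simp] theorem nref_singleton_r (i : ZMod n) : nref {r i} = 0 := by simp [nref]
@[simp] theorem nref_singleton_sr (i : ZMod n) : nref {sr i} = 1 := by simp [nref]
@[simp] theorem idxSum_singleton_r (i : ZMod n) : idxSum {r i} = i := by simp [idxSum]
@[simp] theorem idxSum_singleton_sr (i : ZMod n) : idxSum {sr i} = i := by simp [idxSum]

@[simp] theorem nref_cons (g : DihedralGroup n) (S : Multiset (DihedralGroup n)) :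
    nref (g ::ₘ S) = nref {g} + nref S := by rw [← Multiset.singleton_add, map_add]

@[simp] theorem idxSum_cons (g : DihedralGroup n) (S : Multiset (DihedralGroup n)) :
    idxSum (g ::ₘ S) = idxSum {g} + idxSum S := by rw [← Multiset.singleton_add, map_add]

@[simp] theorem nref_map_r (R : Multiset (ZMod n)) : nref (R.map r) = 0 := by simp [nref]
@[simp] theorem nref_map_sr (R : Multiset (ZMod n)) : nref (R.map sr) = R.card := by simp [nref]
@[simp] theorem idxSum_map_r (R : Multiset (ZMod n)) : idxSum (R.map r) = R.sum := by simp [idxSum]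
@[simp] theorem idxSum_map_sr (R : Multiset (ZMod n)) : idxSum (R.map sr) = R.sum := by
  simp [idxSum]

theorem exists_eq_map_sr_add_map_r (S : Multiset (DihedralGroup n)) :
    ∃ A R : Multiset (ZMod n), S = A.map sr + R.map r := by
  induction S using Multiset.induction_on with
  | empty => exact ⟨0, 0, by simp⟩
  | cons g S ih =>
    obtain ⟨A, R, rfl⟩ := ih
    cases g with
    | r i => exact ⟨A, i ::ₘ R, by simp⟩
    | sr i => exact ⟨i ::ₘ A, R, by simp⟩

theorem exists_eq_map_r_of_nref_eq_zero {S : Multiset (DihedralGroup n)} (h : nref S = 0) :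
    ∃ R : Multiset (ZMod n), S = R.map r := by
  obtain ⟨A, R, rfl⟩ := exists_eq_map_sr_add_map_r S
  have : A = 0 := by simpa using h
  exact ⟨R, by simp [this]⟩

/-- The sequence splits into two parts with equally many reflections and equal index sums. -/
def Balanced (S : Multiset (DihedralGroup n)) : Prop :=
  ∃ Y Z, Y + Z = S ∧ nref Y = nref Z ∧ idxSum Y = idxSum Z

theorem exists_signing (l : List (DihedralGroup n)) :
    ∃ Y Z : Multiset (DihedralGroup n), Y + Z = (l : Multiset _) ∧
      ((∃ v, l.prod = r v ∧ nref Y = nref Z ∧ idxSum Y = v + idxSum Z) ∨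
        ∃ v, l.prod = sr v ∧ nref Y = nref Z + 1 ∧ idxSum Y = v + idxSum Z) := by
  induction l with
  | nil => exact ⟨0, 0, by simp, Or.inl ⟨0, by simp, by simp, by simp⟩⟩
  | cons g l ih =>
    obtain ⟨Y, Z, hl, h⟩ := ih
    rcases h with ⟨v, hv, h1, h2⟩ | ⟨v, hv, h1, h2⟩
    · refine ⟨g ::ₘ Y, Z, by rw [← Multiset.cons_coe, ← hl]; simp, ?_⟩
      cases g with
      | r i => exact Or.inl ⟨i + v, by simp [hv], by simp [h1], by simp [h2, add_assoc]⟩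
      | sr i => exact Or.inr ⟨i + v, by simp [hv], by simp [h1, add_comm], by simp [h2, add_assoc]⟩
    · refine ⟨Y, g ::ₘ Z, by rw [← Multiset.cons_coe, ← hl]; simp, ?_⟩
      cases g with
      | r i => exact Or.inr ⟨v - i, by simp [hv], by simp [h1], by simp [h2]; ring⟩
      | sr i => exact Or.inl ⟨v - i, by simp [hv], by simp [h1, add_comm], by simp [h2]; ring⟩

theorem IsProductOne.balanced {S : Multiset (DihedralGroup n)} (h : IsProductOne S) :
    Balanced S := by
  obtain ⟨l, rfl, hl⟩ := h
  obtain ⟨Y, Z, hYZ, ⟨v, hv, h1, h2⟩ | ⟨v, hv, h1, h2⟩⟩ := exists_signing l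
  · rw [hl, one_def, r.injEq] at hv
    exact ⟨Y, Z, hYZ, h1, by simpa [← hv] using h2⟩
  · rw [hl, one_def] at hv
    exact absurd hv (by rintro ⟨⟩)

theorem prod_map_r (l : List (ZMod n)) : (l.map r).prod = r l.sum := by
  induction l with
  | nil => simp
  | cons i l ih => simp [ih]

theorem exists_list_map_r (R : Multiset (ZMod n)) :
    ∃ l : List (DihedralGroup n), (l : Multiset _) = R.map r ∧ l.prod = r R.sum := by
  obtain ⟨l, rfl⟩ := Quot.exists_rep R
  exact ⟨l.map r, by simp, by rw [prod_map_r]; simp⟩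

theorem isProductOne_map_r_iff {R : Multiset (ZMod n)} :
    IsProductOne (R.map r) ↔ R.sum = 0 := by
  constructor
  · rintro ⟨l, hl, hprod⟩
    obtain ⟨l', rfl, rfl⟩ := exists_list_map_eq l hl.symm
    rw [prod_map_r, one_def, r.injEq] at hprod
    simpa using hprod
  · intro h
    obtain ⟨l, hl, hprod⟩ := exists_list_map_r R
    exact ⟨l, hl, by rw [hprod, h, r_zero]⟩

theorem isProductOne_iff_of_nref_eq_zero {S : Multiset (DihedralGroup n)} (h : nref S = 0) :
    IsProductOne S ↔ idxSum S = 0 := by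
  obtain ⟨R, rfl⟩ := exists_eq_map_r_of_nref_eq_zero h
  rw [isProductOne_map_r_iff, idxSum_map_r]

theorem exists_list_map_sr (A B : Multiset (ZMod n)) (h : A.card = B.card) :
    ∃ l : List (DihedralGroup n), (l : Multiset _) = A.map sr + B.map sr ∧
      l.prod = r (A.sum - B.sum) := by
  induction A using Multiset.induction_on generalizing B with
  | empty =>
    have hB : B = 0 := by simpa [eq_comm] using h
    exact ⟨[], by simp [hB], by simp [hB]⟩
  | cons a A ih =>
    obtain ⟨b, hb⟩ := Multiset.card_pos_iff_exists_mem.1 (show 0 < B.card by simp [← h])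
    obtain ⟨B, rfl⟩ := Multiset.exists_cons_of_mem hb
    obtain ⟨l, hl, hprod⟩ := ih B (by simpa using h)
    refine ⟨sr b :: sr a :: l, ?_, ?_⟩
    · rw [← Multiset.cons_coe, ← Multiset.cons_coe, hl, Multiset.map_cons, Multiset.map_cons,
        Multiset.cons_add, Multiset.add_cons, Multiset.cons_swap]
    · rw [List.prod_cons, List.prod_cons, hprod, ← mul_assoc, sr_mul_sr, r_mul_r,
        Multiset.sum_cons, Multiset.sum_cons]
      congr 1; abel

theorem Balanced.isProductOne {S : Multiset (DihedralGroup n)} (h : Balanced S)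
    (h0 : nref S ≠ 0) : IsProductOne S := by
  obtain ⟨Y, Z, rfl, hn, hs⟩ := h
  obtain ⟨A, P, rfl⟩ := exists_eq_map_sr_add_map_r Y
  obtain ⟨B, Q, rfl⟩ := exists_eq_map_sr_add_map_r Z
  simp only [map_add, nref_map_sr, nref_map_r, idxSum_map_sr, idxSum_map_r, add_zero] at hn hs h0
  obtain ⟨a, ha⟩ := Multiset.card_pos_iff_exists_mem.1 (show 0 < A.card by omega)
  obtain ⟨b, hb⟩ := Multiset.card_pos_iff_exists_mem.1 (show 0 < B.card by omega)
  obtain ⟨A, rfl⟩ := Multiset.exists_cons_of_mem ha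
  obtain ⟨B, rfl⟩ := Multiset.exists_cons_of_mem hb
  obtain ⟨l, hl, hlp⟩ := exists_list_map_sr A B (by simpa using hn)
  obtain ⟨p, hp, hpp⟩ := exists_list_map_r P
  obtain ⟨q, hq, hqp⟩ := exists_list_map_r Q
  refine ⟨p ++ ([sr b] ++ (q ++ ([sr a] ++ l))), ?_, ?_⟩
  · simp only [← Multiset.coe_add, hl, hp, hq, ← Multiset.singleton_add,
      Multiset.map_add, Multiset.map_singleton, Multiset.coe_singleton]
    abel
  · simp only [List.prod_append, hlp, hpp, hqp, List.prod_singleton, r_mul_sr, sr_mul_r, sr_mul_sr,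
      r_mul_r, one_def, r.injEq]
    simp only [Multiset.sum_cons] at hs
    linear_combination hs

/-- A product-one sequence of rotations that is an atom has length at most `n`. -/
theorem IsAtomSeq.card_le_of_nref_eq_zero [NeZero n] {U : Multiset (DihedralGroup n)}
    (hU : IsAtomSeq U) (h : nref U = 0) : U.card ≤ n := by
  obtain ⟨R, rfl⟩ := exists_eq_map_r_of_nref_eq_zero h
  obtain ⟨i, hi⟩ := Multiset.card_pos_iff_exists_mem.1 (by simpa using hU.card_pos)
  obtain ⟨R, rfl⟩ := Multiset.exists_cons_of_mem hi
  have hsum := isProductOne_map_r_iff.1 hU.isProductOne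
  have hfree : ∀ T ≤ R, (T.map id).sum = 0 → T = 0 := by
    intro T hT hT0
    rw [Multiset.map_id] at hT0
    obtain ⟨C, rfl⟩ := Multiset.le_iff_exists_add.1 hT
    have := hU.2.2 (T.map r) ((i ::ₘ C).map r) (by simp) (isProductOne_map_r_iff.2 hT0)
      (isProductOne_map_r_iff.2 (by simpa [hT0, add_left_comm] using hsum))
    simpa using this
  have h1 := card_lt_ncard_subsums_of_zeroFree hfree
  have h2 := Set.ncard_le_card (subsums id R)
  rw [Nat.card_zmod] at h2
  simp only [Multiset.card_map, Multiset.card_cons]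
  omega

end Dihedral

end ProductOne

namespace ProductOne

open DihedralGroup

section Blocks

variable {n : ℕ}

/-- A block is a pair of reflections to be placed on opposite sides of a splitting, or a single
rotation. -/
inductive Block (n : ℕ)
  | pair (a b : ZMod n)
  | rot (i : ZMod n)

namespace Block

/-- The part of the block on the preferred side. -/
def fst : Block n → Multiset (DihedralGroup n)
  | pair a _ => {sr a}
  | rot i => {r i}

/-- The part of the block on the opposite side. -/
def snd : Block n → Multiset (DihedralGroup n)
  | pair _ b => {sr b}
  | rot _ => 0

/-- The difference of the index sums of the two sides. -/
def weight : Block n → ZMod n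
  | pair a b => a - b
  | rot i => i

/-- The sequence of all terms in a family of blocks. -/
def total (M : Multiset (Block n)) : Multiset (DihedralGroup n) :=
  (M.map fst).sum + (M.map snd).sum

theorem nref_sum_fst (M : Multiset (Block n)) :
    nref (M.map fst).sum = nref (M.map snd).sum := by
  induction M using Multiset.induction_on with
  | empty => simp
  | cons x M ih => cases x <;> simp [fst, snd, ih]

theorem idxSum_sum_fst (M : Multiset (Block n)) :
    idxSum (M.map fst).sum = (M.map weight).sum + idxSum (M.map snd).sum := by
  induction M using Multiset.induction_on with
  | empty => simp
  | cons x M ih => cases x <;> simp [fst, snd, weight, ih] <;> ring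

theorem total_add (M N : Multiset (Block n)) : total (M + N) = total M + total N := by
  simp only [total, Multiset.map_add, Multiset.sum_add]; abel

theorem card_le_card_total (M : Multiset (Block n)) : M.card ≤ (total M).card := by
  induction M using Multiset.induction_on with
  | empty => simp
  | cons x M ih =>
    rw [← Multiset.singleton_add, total_add, Multiset.card_add, Multiset.card_add]
    cases x <;> simp [total, fst, snd] at ih ⊢ <;> omega

theorem card_total_le (M : Multiset (Block n)) : (total M).card ≤ 2 * M.card := by
  induction M using Multiset.induction_on with
  | empty => simp [total]
  | cons x M ih =>
    rw [← Multiset.singleton_add, total_add, Multiset.card_add, Multiset.card_add]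
    cases x <;> simp [total, fst, snd] at ih ⊢ <;> omega

theorem idxSum_total_of_nref_eq_zero {M : Multiset (Block n)} (h : nref (total M) = 0) :
    idxSum (total M) = (M.map weight).sum := by
  induction M using Multiset.induction_on with
  | empty => simp [total]
  | cons x M ih =>
    rw [← Multiset.singleton_add, total_add, map_add, add_eq_zero] at h
    rw [← Multiset.singleton_add, total_add, map_add, ih h.2, Multiset.map_add, Multiset.sum_add]
    cases x with
    | pair a b => simp [total, fst, snd] at h
    | rot i => simp [total, fst, snd, weight]

theorem exists_pairs (A B : Multiset (ZMod n)) (h : A.card = B.card) :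
    ∃ N : Multiset (Block n), total N = A.map sr + B.map sr ∧
      (N.map weight).sum = A.sum - B.sum ∧ N.card = A.card := by
  induction A using Multiset.induction_on generalizing B with
  | empty =>
    have hB : B = 0 := by simpa [eq_comm] using h
    exact ⟨0, by simp [hB, total], by simp [hB], by simp⟩
  | cons a A ih =>
    obtain ⟨b, hb⟩ := Multiset.card_pos_iff_exists_mem.1 (show 0 < B.card by simp [← h])
    obtain ⟨B, rfl⟩ := Multiset.exists_cons_of_mem hb
    obtain ⟨N, h1, h2, h3⟩ := ih B (by simpa using h)
    refine ⟨pair a b ::ₘ N, ?_, ?_, by simp [h3]⟩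
    · rw [← Multiset.singleton_add, total_add, h1]
      simp [total, fst, snd]
      exact Multiset.cons_swap _ _ _
    · simp [weight, h2]; ring

theorem total_map_rot (R : Multiset (ZMod n)) : total (R.map rot) = R.map r := by
  induction R using Multiset.induction_on with
  | empty => simp [total]
  | cons i R ih =>
    rw [Multiset.map_cons, ← Multiset.singleton_add, total_add, ih]
    simp [total, fst, snd]

theorem sum_weight_map_rot (R : Multiset (ZMod n)) : ((R.map rot).map weight).sum = R.sum := by
  simp [Multiset.map_map, Function.comp_def, weight]

end Block

open Block

theorem exists_two_mul_eq (hodd : Odd n) (t : ZMod n) : ∃ c, 2 * c = t := by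
  obtain ⟨k, hk⟩ := hodd
  refine ⟨(k + 1) * t, ?_⟩
  have h : (2 * k + 1 : ZMod n) = 0 := by
    have := ZMod.natCast_self n
    rw [hk] at this ⊢
    exact_mod_cast this
  linear_combination t * h

theorem eq_of_two_mul_eq (hodd : Odd n) {a b : ZMod n} (h : 2 * a = 2 * b) : a = b := by
  obtain ⟨c, hc⟩ := exists_two_mul_eq hodd 1
  linear_combination c * h - (a - b) * hc

theorem balanced_of_blocks {Y Z : Multiset (DihedralGroup n)} (hn : nref Y = nref Z)
    {t u : Multiset (Block n)}
    (h : 2 * (t.map weight).sum + idxSum Y - idxSum Z = ((t + u).map weight).sum) :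
    Balanced (Y + Z + total (t + u)) := by
  refine ⟨Y + (t.map fst).sum + (u.map snd).sum, Z + (t.map snd).sum + (u.map fst).sum, ?_, ?_, ?_⟩
  · rw [total_add, total, total]; abel
  · simp only [map_add, nref_sum_fst, hn]
  · simp only [map_add, idxSum_sum_fst]
    rw [Multiset.map_add, Multiset.sum_add] at h
    linear_combination h

theorem balanced_of_subsums_eq_univ (hodd : Odd n) {Y Z : Multiset (DihedralGroup n)}
    (hn : nref Y = nref Z) {M : Multiset (Block n)} (hM : subsums weight M = Set.univ) :
    Balanced (Y + Z + total M) := by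
  obtain ⟨c, hc⟩ := exists_two_mul_eq hodd ((M.map weight).sum - idxSum Y + idxSum Z)
  obtain ⟨t, ht, hs⟩ : c ∈ subsums weight M := hM ▸ Set.mem_univ c
  obtain ⟨u, rfl⟩ := Multiset.le_iff_exists_add.1 ht
  exact balanced_of_blocks hn (by rw [hs]; linear_combination hc)

theorem balanced_of_removable {Y Z : Multiset (DihedralGroup n)} (hn : nref Y = nref Z)
    {t u T C : Multiset (Block n)} (htu : t + u = T + C)
    (h : 2 * (t.map weight).sum + idxSum Y - idxSum Z = ((t + u).map weight).sum)
    (hT : (T.map weight).sum = 0) (hst : ∀ i ∈ T, Stable (subsums weight C) (weight i)) :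
    Balanced (Y + Z + total C) := by
  rw [htu, Multiset.map_add, Multiset.sum_add, hT, zero_add] at h
  obtain ⟨tT, tC, uT, uC, rfl, -, rfl, rfl⟩ := exists_refinement htu
  have h1 : (tC.map weight).sum + (tT.map weight).sum ∈ subsums weight (tC + uC) :=
    Stable.multiset_sum (fun i hi => hst i (by simp [hi])) _
      ⟨tC, Multiset.le_add_right _ _, rfl⟩
  obtain ⟨s, hs, hsum⟩ := h1
  obtain ⟨v, hv⟩ := Multiset.le_iff_exists_add.1 hs
  rw [hv]
  refine balanced_of_blocks hn ?_
  rw [← hv, hsum, ← h, Multiset.map_add, Multiset.sum_add]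
  ring

theorem isProductOne_total {T : Multiset (Block n)} (hT : (T.map weight).sum = 0) :
    IsProductOne (total T) := by
  by_cases h : nref (total T) = 0
  · rw [isProductOne_iff_of_nref_eq_zero h, idxSum_total_of_nref_eq_zero h, hT]
  · refine Balanced.isProductOne ?_ h
    simpa using balanced_of_blocks (Y := 0) (Z := 0) rfl (t := T) (u := 0) (by simp [hT])

theorem total_ne_zero {T : Multiset (Block n)} (hT : T ≠ 0) : total T ≠ 0 := by
  have h1 := card_le_card_total T
  have h2 := Multiset.card_pos.2 hT
  rw [← Multiset.card_pos]
  omega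

theorem isProductOne_sr_sr (g : ZMod n) : IsProductOne ({sr g, sr g} : Multiset _) :=
  ⟨[sr g, sr g], rfl, by simp⟩

/-- The sequence contains a nontrivial product-one part of length at most `n` whose complement
is product-one. -/
def HasShortPart (S : Multiset (DihedralGroup n)) : Prop :=
  ∃ T C, T + C = S ∧ T ≠ 0 ∧ T.card ≤ n ∧ IsProductOne T ∧ IsProductOne C

theorem hasShortPart_of_repeated [NeZero n] (hn : 3 ≤ n) (hodd : Odd n) {g : ZMod n}
    {A B P Q : Multiset (ZMod n)} (hAB : A.card + 2 = B.card)
    (hsum : g + g + A.sum + P.sum = B.sum + Q.sum)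
    (hcard : 2 * n + 2 ≤ 2 * B.card + P.card + Q.card) :
    HasShortPart ((g ::ₘ g ::ₘ A).map sr + B.map sr + (P + Q).map r) := by
  obtain ⟨b, hb⟩ := Multiset.card_pos_iff_exists_mem.1 (show 0 < B.card by omega)
  obtain ⟨B, rfl⟩ := Multiset.exists_cons_of_mem hb
  rw [Multiset.card_cons] at hAB
  obtain ⟨b', hb'⟩ := Multiset.card_pos_iff_exists_mem.1 (show 0 < B.card by omega)
  obtain ⟨B, rfl⟩ := Multiset.exists_cons_of_mem hb'
  simp only [Multiset.card_cons] at hAB hcard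
  obtain ⟨N, hN, hNw, hNc⟩ := exists_pairs A B (by omega)
  set t := N + P.map rot
  set u := Q.map rot
  have htot : total (t + u) = A.map sr + B.map sr + (P + Q).map r := by
    simp only [t, u, total_add, total_map_rot, hN, Multiset.map_add]; abel
  have hnref : nref ({sr g, sr g} : Multiset (DihedralGroup n)) = nref {sr b, sr b'} := by simp
  have hw : 2 * (t.map weight).sum + idxSum {sr g, sr g} - idxSum {sr b, sr b'} =
      ((t + u).map weight).sum := by
    simp only [t, u, Multiset.map_add, Multiset.sum_add, sum_weight_map_rot, hNw,
      Multiset.insert_eq_cons, idxSum_cons, idxSum_singleton_sr]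
    simp only [Multiset.sum_cons] at hsum
    linear_combination hsum
  have hS : (g ::ₘ g ::ₘ A).map sr + (b ::ₘ b' ::ₘ B).map sr + (P + Q).map r =
      {sr g, sr g} + {sr b, sr b'} + total (t + u) := by
    rw [htot]
    simp only [Multiset.insert_eq_cons, ← Multiset.singleton_add, Multiset.map_add,
      Multiset.map_singleton]
    abel
  have hMc : n ≤ (t + u).card + 1 := by
    simp only [t, u, Multiset.card_add, Multiset.card_map]; omega
  rw [hS]
  rcases subsums_eq_univ_or_exists_removable (by simpa using hodd) weight (t + u)
    (by simpa using hMc) with huniv | ⟨T, C, hTC, hT0, hTc, hTs, hst⟩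
  · refine ⟨{sr g, sr g}, {sr b, sr b'} + total (t + u), by abel, by simp, by simp; omega,
      isProductOne_sr_sr g, ?_⟩
    refine Balanced.isProductOne ?_ (by simp)
    have := balanced_of_subsums_eq_univ hodd (Y := {sr b}) (Z := {sr b'}) (by simp) huniv
    simpa using this
  · refine ⟨total T, {sr g, sr g} + {sr b, sr b'} + total C, ?_, total_ne_zero hT0, ?_,
      isProductOne_total hTs, (balanced_of_removable hnref hTC hw hTs hst).isProductOne (by simp)⟩
    · rw [hTC, total_add]; abel
    · have := card_total_le T
      rw [Nat.card_zmod] at hTc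
      omega

theorem subsums_map {α β H : Type*} [AddCommGroup H] (x : β → H) (f : α → β) (M : Multiset α) :
    subsums x (M.map f) = subsums (x ∘ f) M := by
  ext h
  constructor
  · rintro ⟨t, ht, rfl⟩
    obtain ⟨u, hu⟩ := Multiset.le_iff_exists_add.1 ht
    obtain ⟨t, u, rfl, rfl, -⟩ := exists_add_of_map_eq_add hu
    exact ⟨t, Multiset.le_add_right _ _, by rw [Multiset.map_map]⟩
  · rintro ⟨t, ht, rfl⟩
    exact ⟨t.map f, Multiset.map_le_map ht, by rw [Multiset.map_map]⟩

theorem isProductOne_of_full (hodd : Odd n) {Y Z : Multiset (DihedralGroup n)}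
    (hn : nref Y = nref Z) (hY : nref Y ≠ 0) {I R : Multiset (ZMod n)}
    (hI : subsums id I = Set.univ) (hIR : I ≤ R) : IsProductOne (Y + Z + R.map r) := by
  refine Balanced.isProductOne ?_ (by simp [hY])
  rw [← total_map_rot]
  refine balanced_of_subsums_eq_univ hodd hn ?_
  rw [subsums_map]
  exact Set.eq_univ_of_univ_subset (hI ▸ subsums_mono hIR)

theorem hasShortPart_of_full [NeZero n] (hodd : Odd n)
    {A B R : Multiset (ZMod n)} (hAB : A.card = B.card) (hA : 2 ≤ A.card)
    (hnd : (A + B).Nodup) (hR : subsums id R = Set.univ) (hn : 2 * B.card + 1 ≤ n)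
    (hcard : 2 * n + 2 ≤ 2 * B.card + R.card) :
    HasShortPart (A.map sr + B.map sr + R.map r) := by
  classical
  obtain ⟨I, J, rfl, hI, hJ⟩ := exists_subsums_stable id R
  rw [subsums_add_eq hJ] at hR
  have hIc : I.card + 1 ≤ n := by
    rwa [hR, Set.ncard_univ, Nat.card_zmod] at hI
  rw [Multiset.card_add] at hcard
  obtain ⟨K, J, rfl, hK⟩ := exists_add_card_eq (s := J) (k := n + 2 - 2 * B.card) (by omega)
  by_cases hzero : ∀ T ≤ K, (T.map id).sum = 0 → T = 0
  swap
  · push Not at hzero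
    obtain ⟨T, hT, hTs, hT0⟩ := hzero
    obtain ⟨K, rfl⟩ := Multiset.le_iff_exists_add.1 hT
    refine ⟨T.map r, A.map sr + B.map sr + (I + (K + J)).map r, ?_, by simpa using hT0, ?_,
      isProductOne_map_r_iff.2 (by simpa using hTs), isProductOne_of_full hodd (by simp [hAB])
        (by rw [nref_map_sr]; omega) hR (Multiset.le_add_right _ _)⟩
    · simp only [Multiset.map_add]; abel
    · rw [Multiset.card_add] at hK
      rw [Multiset.card_map]; omega
  have hsub := card_lt_ncard_subsums_of_zeroFree hzero
  set F := (A + B).toFinset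
  have hF : F.card = 2 * B.card := by
    rw [Multiset.toFinset_card_of_nodup hnd, Multiset.card_add]; omega
  set X := (subsums id K).toFinite.toFinset
  have hX : n + 3 - 2 * B.card ≤ X.card := by
    rw [Set.ncard_eq_toFinset_card _ (subsums id K).toFinite] at hsub
    simp only [X]; omega
  obtain ⟨p, hp, q, hq, hpq, heq⟩ : ∃ p ∈ F ×ˢ X, ∃ q ∈ F ×ˢ X, p ≠ q ∧ p.1 + p.2 = q.1 + q.2 := by
    refine Finset.exists_ne_map_eq_of_card_lt_of_maps_to (t := Finset.univ) ?_ (by simp)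
    rw [Finset.card_univ, ZMod.card, Finset.card_product, hF]
    obtain ⟨b, hb⟩ := Nat.exists_eq_add_of_le (show 2 ≤ B.card by omega)
    obtain ⟨c, hc⟩ := Nat.exists_eq_add_of_le hn
    have : c + 4 ≤ X.card := by omega
    calc n < 2 * B.card * (c + 4) := hc.trans_lt (by rw [hb]; nlinarith [Nat.zero_le (b * c)])
      _ ≤ _ := Nat.mul_le_mul_left _ this
  simp only [Finset.mem_product, X, Set.Finite.mem_toFinset] at hp hq
  obtain ⟨⟨hpF, y, hy, hys⟩, hqF, z, hz, hzs⟩ := And.intro hp hq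
  rw [Multiset.map_id] at hys hzs
  have hne : p.1 ≠ q.1 := by
    intro h
    rw [h, add_right_inj] at heq
    exact hpq (Prod.ext h heq)
  set c := y ∩ z
  have hyc : y - z + c = y := by rw [Multiset.sub_add_inter]
  have hzc : z - y + c = z := by
    rw [show c = z ∩ y from Multiset.inter_comm _ _, Multiset.sub_add_inter]
  have hle : (y - z) + (z - y) ≤ K := by
    rw [Multiset.le_iff_count] at hy hz ⊢
    intro a
    have h1 := hy a
    have h2 := hz a
    rw [Multiset.count_add, Multiset.count_sub, Multiset.count_sub]
    omega
  obtain ⟨K', hK'⟩ := Multiset.le_iff_exists_add.1 hle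
  have hle2 : ({p.1, q.1} : Multiset (ZMod n)) ≤ A + B := by
    rw [Multiset.le_iff_subset (by simpa using hne)]
    intro a ha
    simp only [Multiset.insert_eq_cons, Multiset.mem_cons, Multiset.mem_singleton] at ha
    rcases ha with rfl | rfl
    · exact Multiset.mem_toFinset.1 hpF
    · exact Multiset.mem_toFinset.1 hqF
  obtain ⟨E, hE⟩ := Multiset.le_iff_exists_add.1 hle2
  have hEc : E.card + 2 = 2 * B.card := by
    have := congrArg Multiset.card hE
    rw [Multiset.card_add, Multiset.card_add, Multiset.card_pair] at this
    omega
  obtain ⟨E₁, E₂, rfl, hE₁⟩ := exists_add_card_eq (s := E) (k := B.card - 1) (by omega)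
  rw [Multiset.card_add] at hEc
  refine ⟨({sr p.1} + (y - z).map r) + ({sr q.1} + (z - y).map r),
    E₁.map sr + E₂.map sr + (I + (K' + J)).map r, ?_, by simp, ?_, ?_, isProductOne_of_full hodd
      (by rw [nref_map_sr, nref_map_sr]; omega) (by rw [nref_map_sr]; omega) hR
      (Multiset.le_add_right _ _)⟩
  · rw [← Multiset.map_add sr A B, hE, hK']
    simp only [Multiset.map_add, Multiset.insert_eq_cons, ← Multiset.singleton_add,
      Multiset.map_singleton]
    abel
  · have := Multiset.card_le_card hle
    rw [Multiset.card_add] at this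
    simp only [Multiset.card_add, Multiset.card_singleton, Multiset.card_map]
    omega
  · refine Balanced.isProductOne ⟨_, _, rfl, by simp, ?_⟩ (by simp)
    have h1 := congrArg Multiset.sum hyc
    have h2 := congrArg Multiset.sum hzc
    rw [Multiset.sum_add] at h1 h2
    simp only [map_add, idxSum_singleton_sr, idxSum_map_r]
    linear_combination heq + h1 - h2 + hys - hzs

theorem hasShortPart_of_nodup [NeZero n] (hodd : Odd n)
    {A B P Q : Multiset (ZMod n)} (hAB : A.card = B.card) (hA : 2 ≤ A.card)
    (hnd : (A + B).Nodup) (hsum : A.sum + P.sum = B.sum + Q.sum)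
    (hcard : 2 * n + 2 ≤ 2 * B.card + P.card + Q.card) :
    HasShortPart (A.map sr + B.map sr + (P + Q).map r) := by
  classical
  have hn2 : 2 * B.card ≤ n := by
    have h1 := Multiset.toFinset_card_of_nodup hnd
    have h2 := Finset.card_le_univ (A + B).toFinset
    rw [h1, ZMod.card, Multiset.card_add] at h2
    omega
  have hn3 : 2 * B.card + 1 ≤ n := by
    obtain ⟨k, hk⟩ := hodd
    omega
  have hnref : nref (A.map sr) = nref (B.map sr) := by simp [hAB]
  set t := P.map rot
  set u := Q.map rot
  have htot : total (t + u) = (P + Q).map r := by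
    simp only [t, u, total_add, total_map_rot, Multiset.map_add]
  have hw : 2 * (t.map weight).sum + idxSum (A.map sr) - idxSum (B.map sr) =
      ((t + u).map weight).sum := by
    simp only [t, u, Multiset.map_add, Multiset.sum_add, sum_weight_map_rot, idxSum_map_sr]
    linear_combination hsum
  have hMc : (t + u).card = P.card + Q.card := by simp [t, u]
  have hrefs : ∀ C : Multiset (DihedralGroup n), nref (A.map sr + B.map sr + C) ≠ 0 := by
    intro C; simp only [map_add, nref_map_sr]; omega
  rw [← htot]
  rcases subsums_eq_univ_or_exists_removable (by simpa using hodd) weight (t + u)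
    (by rw [Nat.card_zmod]; omega) with huniv | ⟨T, C, hTC, hT0, hTc, hTs, hst⟩
  swap
  · refine ⟨total T, A.map sr + B.map sr + total C, by rw [hTC, total_add]; abel,
      total_ne_zero hT0, ?_, isProductOne_total hTs,
      (balanced_of_removable hnref hTC hw hTs hst).isProductOne (hrefs _)⟩
    have := card_total_le T
    rw [Nat.card_zmod] at hTc
    omega
  rw [htot]
  refine hasShortPart_of_full hodd hAB hA hnd ?_ hn3 (by rw [Multiset.card_add]; omega)
  rwa [show t + u = (P + Q).map rot by simp [t, u], subsums_map] at huniv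

theorem hasShortPart_of_common (hn : 3 ≤ n) {g : ZMod n} {A B P Q : Multiset (ZMod n)}
    (hAB : A.card = B.card) (hA : 1 ≤ A.card) (hsum : A.sum + P.sum = B.sum + Q.sum) :
    HasShortPart ((g ::ₘ A).map sr + (g ::ₘ B).map sr + (P + Q).map r) := by
  refine ⟨{sr g, sr g}, (A.map sr + P.map r) + (B.map sr + Q.map r), ?_, by simp, by simp; omega,
    isProductOne_sr_sr g, Balanced.isProductOne ⟨_, _, rfl, by simp [hAB], by simpa using hsum⟩ ?_⟩
  · simp only [Multiset.map_add, Multiset.insert_eq_cons, ← Multiset.singleton_add,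
      Multiset.map_singleton]
    abel
  · simp only [map_add, nref_map_sr]; omega

theorem hasShortPart_add [NeZero n] (hn : 3 ≤ n) (hodd : Odd n) {Y Z : Multiset (DihedralGroup n)}
    (hnref : nref Y = nref Z) (hidx : idxSum Y = idxSum Z) (hY : 2 ≤ nref Y)
    (hcard : 2 * n + 2 ≤ Y.card + Z.card) : HasShortPart (Y + Z) := by
  classical
  obtain ⟨A, P, rfl⟩ := exists_eq_map_sr_add_map_r Y
  obtain ⟨B, Q, rfl⟩ := exists_eq_map_sr_add_map_r Z
  simp only [map_add, nref_map_sr, nref_map_r, idxSum_map_sr, idxSum_map_r, add_zero,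
    Multiset.card_add, Multiset.card_map] at *
  have hre : ∀ A B P Q : Multiset (ZMod n), A.map sr + P.map r + (B.map sr + Q.map r) =
      A.map sr + B.map sr + (P + Q).map r := by
    intro A B P Q; rw [Multiset.map_add]; abel
  by_cases hnd : (A + B).Nodup
  · rw [hre]
    exact hasShortPart_of_nodup hodd hnref hY hnd hidx (by omega)
  rw [Multiset.nodup_add] at hnd
  by_cases hAnd : A.Nodup
  swap
  · obtain ⟨g, hg⟩ : ∃ g, ({g, g} : Multiset _) ≤ A := by
      rw [Multiset.nodup_iff_le] at hAnd; push Not at hAnd; exact hAnd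
    obtain ⟨A, rfl⟩ := Multiset.le_iff_exists_add.1 hg
    rw [hre]
    simp only [Multiset.insert_eq_cons, Multiset.cons_add, Multiset.singleton_add,
      Multiset.card_cons, Multiset.sum_cons] at *
    exact hasShortPart_of_repeated hn hodd hnref (by rw [← hidx]; ring) (by omega)
  by_cases hBnd : B.Nodup
  swap
  · obtain ⟨g, hg⟩ : ∃ g, ({g, g} : Multiset _) ≤ B := by
      rw [Multiset.nodup_iff_le] at hBnd; push Not at hBnd; exact hBnd
    obtain ⟨B, rfl⟩ := Multiset.le_iff_exists_add.1 hg
    rw [add_comm, hre]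
    simp only [Multiset.insert_eq_cons, Multiset.cons_add, Multiset.singleton_add,
      Multiset.card_cons, Multiset.sum_cons] at *
    exact hasShortPart_of_repeated hn hodd (by omega) (by rw [hidx]; ring) (by omega)
  obtain ⟨g, hgA, hgB⟩ : ∃ g, g ∈ A ∧ g ∈ B := by
    by_contra h
    push Not at h
    exact hnd ⟨hAnd, hBnd, Multiset.disjoint_left.2 fun {a} => h a⟩
  obtain ⟨A, rfl⟩ := Multiset.exists_cons_of_mem hgA
  obtain ⟨B, rfl⟩ := Multiset.exists_cons_of_mem hgB
  rw [hre]
  simp only [Multiset.card_cons, Multiset.sum_cons] at *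
  exact hasShortPart_of_common hn (by omega) (by omega)
    (by linear_combination hidx)

end Blocks

end ProductOne

namespace ProductOne

open DihedralGroup

section Moves

variable {n : ℕ} {τ : Type*}

/-- The number of reflections in a tagged sequence. -/
def taggedNref : Multiset (τ × DihedralGroup n) →+ ℕ :=
  nref.comp (Multiset.mapAddMonoidHom Prod.snd)

/-- The sum of the indices of the terms of a tagged sequence. -/
def taggedIdxSum : Multiset (τ × DihedralGroup n) →+ ZMod n :=
  idxSum.comp (Multiset.mapAddMonoidHom Prod.snd)

theorem taggedNref_apply (t : Multiset (τ × DihedralGroup n)) :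
    taggedNref t = nref (t.map Prod.snd) := rfl

theorem taggedIdxSum_apply (t : Multiset (τ × DihedralGroup n)) :
    taggedIdxSum t = idxSum (t.map Prod.snd) := rfl

@[simp] theorem taggedIdxSum_sr (o : τ) (a : ZMod n) : taggedIdxSum {(o, sr a)} = a := by
  simp [taggedIdxSum_apply]

@[simp] theorem taggedIdxSum_r (o : τ) (a : ZMod n) : taggedIdxSum {(o, r a)} = a := by
  simp [taggedIdxSum_apply]

@[simp] theorem taggedNref_sr (o : τ) (a : ZMod n) : taggedNref {(o, sr a)} = 1 := by
  simp [taggedNref_apply]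

@[simp] theorem taggedNref_r (o : τ) (a : ZMod n) : taggedNref {(o, r a)} = 0 := by
  simp [taggedNref_apply]

theorem exists_tagged_decomposition (t : Multiset (τ × DihedralGroup n)) :
    ∃ A R : Multiset (τ × ZMod n), t = A.map (Prod.map id sr) + R.map (Prod.map id r) := by
  induction t using Multiset.induction_on with
  | empty => exact ⟨0, 0, by simp⟩
  | cons x t ih =>
    obtain ⟨A, R, rfl⟩ := ih
    obtain ⟨o, i | i⟩ := x
    · exact ⟨A, (o, i) ::ₘ R, by simp⟩
    · exact ⟨(o, i) ::ₘ A, R, by simp⟩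

/-- The tags of the reflections in a tagged sequence. -/
def refTags : Multiset (τ × DihedralGroup n) →+ Multiset τ :=
  Multiset.sumAddMonoidHom.comp
    (Multiset.mapAddMonoidHom fun x => nref {x.2} • ({x.1} : Multiset τ))

theorem refTags_map_sr (A : Multiset (τ × ZMod n)) :
    refTags (A.map (Prod.map id sr)) = A.map Prod.fst := by
  induction A using Multiset.induction_on with
  | empty => simp
  | cons x A ih =>
    rw [Multiset.map_cons, ← Multiset.singleton_add, map_add, ih]
    simp [refTags]

theorem refTags_map_r (A : Multiset (τ × ZMod n)) :
    refTags (A.map (Prod.map id (r : ZMod n → DihedralGroup n))) = 0 := by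
  simp [refTags]

theorem refTags_map_mk (o : τ) (S : Multiset (DihedralGroup n)) :
    refTags (S.map (Prod.mk o)) = nref S • {o} := by
  induction S using Multiset.induction_on with
  | empty => simp
  | cons g S ih =>
    rw [Multiset.map_cons, ← Multiset.singleton_add, map_add, ih, nref_cons, add_smul]
    simp [refTags]

variable [DecidableEq τ]

/-- The tags occurring in a tagged sequence. -/
def tags (t : Multiset (τ × DihedralGroup n)) : Finset τ := (t.map Prod.fst).toFinset

theorem tags_add (s t : Multiset (τ × DihedralGroup n)) : tags (s + t) = tags s ∪ tags t := by
  simp [tags]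

variable (n τ) in
/-- A move on the terms `support`: initially `base` is chosen among them, and we may pass to
`first` or to `second` instead, keeping the number of reflections. -/
structure Move where
  support : Multiset (τ × DihedralGroup n)
  base : Multiset (τ × DihedralGroup n)
  first : Multiset (τ × DihedralGroup n)
  second : Multiset (τ × DihedralGroup n)
  base_le : base ≤ support
  first_le : first ≤ support
  second_le : second ≤ support
  nref_first : taggedNref first = taggedNref base
  nref_second : taggedNref second = taggedNref base
  cheap : (tags support).card ≤ 1 ∨ ((tags support).card ≤ 2 ∧
    taggedIdxSum first - taggedIdxSum base ≠ 0 ∧ taggedIdxSum second - taggedIdxSum base ≠ 0 ∧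
    taggedIdxSum first - taggedIdxSum base ≠ taggedIdxSum second - taggedIdxSum base)

/-- The tagged sequence `s` with chosen part `p` decomposes into moves whose first options change
the index sum of the chosen part by `ε`. -/
def Movable (s p : Multiset (τ × DihedralGroup n)) (ε : ZMod n) : Prop :=
  ∃ M : Multiset (Move n τ), (M.map Move.support).sum = s ∧ (M.map Move.base).sum = p ∧
    (M.map fun m => taggedIdxSum m.first - taggedIdxSum m.base).sum = ε

theorem movable_zero : Movable (0 : Multiset (τ × DihedralGroup n)) 0 0 := ⟨0, by simp⟩

theorem Movable.add {s s' p p' : Multiset (τ × DihedralGroup n)} {ε ε' : ZMod n}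
    (h : Movable s p ε) (h' : Movable s' p' ε') : Movable (s + s') (p + p') (ε + ε') := by
  obtain ⟨M, rfl, rfl, rfl⟩ := h
  obtain ⟨M', rfl, rfl, rfl⟩ := h'
  exact ⟨M + M', by simp, by simp, by rw [Multiset.map_add, Multiset.sum_add]⟩

theorem Move.movable (m : Move n τ) :
    Movable m.support m.base (taggedIdxSum m.first - taggedIdxSum m.base) :=
  ⟨{m}, by simp, by simp, by simp⟩

theorem movable_of_tags_card_le_one {s p e : Multiset (τ × DihedralGroup n)} (hp : p ≤ s)
    (he : e ≤ s) (hn : taggedNref e = taggedNref p) (hs : (tags s).card ≤ 1) :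
    Movable s p (taggedIdxSum e - taggedIdxSum p) :=
  Move.movable ⟨s, p, e, e, hp, he, he, hn, hn, Or.inl hs⟩

theorem movable_rotations (A B C D : Multiset (τ × ZMod n)) :
    Movable ((A + B + C + D).map (Prod.map id r)) ((A + B).map (Prod.map id r))
      ((C.map Prod.snd).sum - (B.map Prod.snd).sum) := by
  have key : ∀ x : τ × ZMod n, ∀ p ≤ ({Prod.map id r x} : Multiset (τ × DihedralGroup n)),
      ∀ e ≤ ({Prod.map id r x} : Multiset (τ × DihedralGroup n)),
      Movable {Prod.map id r x} p (taggedIdxSum e - taggedIdxSum p) := by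
    intro x p hp e he
    have hz : ∀ q ≤ ({Prod.map id r x} : Multiset (τ × DihedralGroup n)), taggedNref q = 0 := by
      intro q hq
      rcases Multiset.le_singleton.1 hq with rfl | rfl <;> simp [Prod.map]
    exact movable_of_tags_card_le_one hp he ((hz _ he).trans (hz _ hp).symm) (by simp [tags])
  have h0 : ∀ g : τ × DihedralGroup n, 0 ≤ ({g} : Multiset _) := fun _ => Multiset.zero_le _
  induction A using Multiset.induction_on with
  | cons x A ih =>
    have := (key x _ le_rfl _ le_rfl).add ih
    simpa [Multiset.singleton_add] using this
  | empty =>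
    induction B using Multiset.induction_on with
    | cons x B ih =>
      have := (key x _ le_rfl _ (h0 _)).add ih
      convert this using 1
      · simp
      · simp
      · simp [Prod.map]; ring
    | empty =>
      induction C using Multiset.induction_on with
      | cons x C ih =>
        have := (key x _ (h0 _) _ le_rfl).add ih
        convert this using 1
        · simp
        · simp
        · simp [Prod.map]
      | empty =>
        induction D using Multiset.induction_on with
        | empty => simpa using movable_zero
        | cons x D ih =>
          have := (key x _ (h0 _) _ (h0 _)).add ih
          convert this using 1
          · simp
          · simp
          · simp

theorem movable_keep (o : τ) (a b : ZMod n) :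
    Movable {(o, sr a), (o, sr b)} {(o, sr a)} 0 := by
  have h : ({(o, sr a)} : Multiset (τ × DihedralGroup n)) ≤ {(o, sr a), (o, sr b)} := by
    simp
  simpa using movable_of_tags_card_le_one h h rfl (by simp [tags])

theorem movable_swap (o : τ) (a b : ZMod n) :
    Movable {(o, sr a), (o, sr b)} {(o, sr a)} (b - a) := by
  have h : ({(o, sr a)} : Multiset (τ × DihedralGroup n)) ≤ {(o, sr a), (o, sr b)} := by
    simp
  have h' : ({(o, sr b)} : Multiset (τ × DihedralGroup n)) ≤ {(o, sr a), (o, sr b)} := by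
    simp
  simpa using movable_of_tags_card_le_one h h' (by simp) (by simp [tags])

theorem movable_double (hodd : Odd n) (o o' : τ) (a a' b b' : ZMod n) :
    Movable ({(o, sr a'), (o, sr a)} + {(o', sr b), (o', sr b')}) ({(o, sr a')} + {(o', sr b)})
      (a - b) := by
  by_cases he : a - b = 0
  · rw [he]
    simpa using (movable_keep o a' a).add (movable_keep o' b b')
  have hsum : ∀ x y : τ × DihedralGroup n, ({x, y} : Multiset _) = {x} + {y} := fun x y => rfl
  have hs : ({(o, sr a'), (o, sr a)} + {(o', sr b), (o', sr b')} :
      Multiset (τ × DihedralGroup n)) =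
      {(o, sr a')} + {(o, sr a)} + {(o', sr b)} + {(o', sr b')} := by
    simp only [hsum]; abel
  have hcard : (tags ({(o, sr a'), (o, sr a)} + {(o', sr b), (o', sr b')} :
      Multiset (τ × DihedralGroup n))).card ≤ 2 := by
    have : tags ({(o, sr a'), (o, sr a)} + {(o', sr b), (o', sr b')} :
      Multiset (τ × DihedralGroup n)) = {o, o'} := by ext; simp [tags]
    rw [this]
    exact Finset.card_le_two
  have key : ∀ f : Multiset (τ × DihedralGroup n),
      f ≤ {(o, sr a'), (o, sr a)} + {(o', sr b), (o', sr b')} → taggedNref f = 2 →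
      taggedIdxSum f - (a' + b) ≠ 0 → a - b ≠ taggedIdxSum f - (a' + b) →
      Movable ({(o, sr a'), (o, sr a)} + {(o', sr b), (o', sr b')}) ({(o, sr a')} + {(o', sr b)})
        (a - b) := by
    intro f hf hf2 hf0 hfe
    have hab : a' + a - (a' + b) = a - b := by ring
    have := Move.movable ⟨{(o, sr a'), (o, sr a)} + {(o', sr b), (o', sr b')},
      {(o, sr a')} + {(o', sr b)}, {(o, sr a')} + {(o, sr a)}, f, ?_, ?_, hf,
      by simp only [map_add, taggedNref_sr], by simp only [map_add, taggedNref_sr, hf2],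
      Or.inr ⟨hcard, ?_⟩⟩
    · simpa only [map_add, taggedIdxSum_sr, hab] using this
    · exact Multiset.le_iff_exists_add.2 ⟨{(o, sr a)} + {(o', sr b')}, by rw [hs]; abel⟩
    · exact Multiset.le_iff_exists_add.2 ⟨{(o', sr b)} + {(o', sr b')}, by rw [hs]; abel⟩
    · simp only [map_add, taggedIdxSum_sr, hab]
      exact ⟨he, hf0, hfe⟩
  by_contra hcon
  have key' : ∀ f : Multiset (τ × DihedralGroup n),
      f ≤ {(o, sr a'), (o, sr a)} + {(o', sr b), (o', sr b')} → taggedNref f = 2 →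
      taggedIdxSum f - (a' + b) = 0 ∨ taggedIdxSum f - (a' + b) = a - b := by
    intro f hf hf2
    by_contra h
    push Not at h
    exact hcon (key f hf hf2 h.1 h.2.symm)
  have h1 := key' ({(o, sr a)} + {(o', sr b)})
    (Multiset.le_iff_exists_add.2 ⟨{(o, sr a')} + {(o', sr b')}, by rw [hs]; abel⟩)
    (by simp only [map_add, taggedNref_sr])
  have h2 := key' ({(o, sr a')} + {(o', sr b')})
    (Multiset.le_iff_exists_add.2 ⟨{(o, sr a)} + {(o', sr b)}, by rw [hs]; abel⟩)
    (by simp only [map_add, taggedNref_sr])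
  have h3 := key' ({(o, sr a)} + {(o', sr b')})
    (Multiset.le_iff_exists_add.2 ⟨{(o, sr a')} + {(o', sr b)}, by rw [hs]; abel⟩)
    (by simp only [map_add, taggedNref_sr])
  have h4 := key' ({(o', sr b)} + {(o', sr b')})
    (Multiset.le_iff_exists_add.2 ⟨{(o, sr a')} + {(o, sr a)}, by rw [hs]; abel⟩)
    (by simp only [map_add, taggedNref_sr])
  simp only [map_add, taggedIdxSum_sr] at h1 h2 h3 h4
  have h5 : 2 * (a - b) ≠ 0 := fun h => he (eq_of_two_mul_eq hodd (by rw [h, mul_zero]))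
  rcases h1 with h1 | h1 <;> rcases h2 with h2 | h2
  · rcases h4 with h4 | h4
    · exact he (by linear_combination h1 + h2 - h4)
    · exact h5 (by linear_combination h1 + h2 - h4)
  · refine hcon ?_
    have := (movable_keep o a' a).add (movable_swap o' b b')
    rwa [show (0 : ZMod n) + (b' - b) = a - b by linear_combination h2] at this
  · refine hcon ?_
    have := (movable_swap o a' a).add (movable_keep o' b b')
    rwa [show a - a' + (0 : ZMod n) = a - b by linear_combination h1] at this
  · rcases h3 with h3 | h3
    · exact h5 (by linear_combination h3 - h1 - h2)
    · exact he (by linear_combination h3 - h1 - h2)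

theorem movable_reflections (hodd : Odd n) (A B C D : Multiset (τ × ZMod n))
    (htags : (A + B).map Prod.fst = (C + D).map Prod.fst) (hcard : A.card = D.card) :
    Movable ((A + B + C + D).map (Prod.map id sr)) ((A + B).map (Prod.map id sr))
      ((C.map Prod.snd).sum - (B.map Prod.snd).sum) := by
  induction hN : (A + B).card using Nat.strong_induction_on generalizing A B C D with
  | _ N ih =>
  have hcons : ∀ {o : τ} {X : Multiset (τ × ZMod n)}, o ∈ X.map Prod.fst →
      ∃ a X', X = (o, a) ::ₘ X' := by
    intro o X h
    obtain ⟨⟨o, a⟩, hx, rfl⟩ := Multiset.mem_map.1 h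
    obtain ⟨X', rfl⟩ := Multiset.exists_cons_of_mem hx
    exact ⟨a, X', rfl⟩
  by_cases hAD : ∃ o, o ∈ A.map Prod.fst ∧ o ∈ D.map Prod.fst
  · obtain ⟨o, hA, hD⟩ := hAD
    obtain ⟨a, A, rfl⟩ := hcons hA
    obtain ⟨d, D, rfl⟩ := hcons hD
    have h := ih _ ?_ A B C D ?_ (by simpa using hcard) rfl
    · convert (movable_keep o a d).add h using 1
      · simp only [Multiset.insert_eq_cons, ← Multiset.singleton_add, Multiset.map_add,
          Multiset.map_singleton, Prod.map, id]
        abel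
      · simp
      · rw [zero_add]
    · rw [← hN]; simp
    · simpa using htags
  by_cases hBC : ∃ o, o ∈ B.map Prod.fst ∧ o ∈ C.map Prod.fst
  · obtain ⟨o, hB, hC⟩ := hBC
    obtain ⟨b, B, rfl⟩ := hcons hB
    obtain ⟨c, C, rfl⟩ := hcons hC
    have h := ih _ ?_ A B C D ?_ hcard rfl
    · convert (movable_swap o b c).add h using 1
      · simp only [Multiset.insert_eq_cons, ← Multiset.singleton_add, Multiset.map_add,
          Multiset.map_singleton, Prod.map, id]
        abel
      · simp
      · simp; ring
    · rw [← hN]; simp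
    · simpa using htags
  push Not at hAD hBC
  rcases Multiset.empty_or_exists_mem A with rfl | ⟨⟨o, a⟩, hA⟩
  · have hD : D = 0 := by simpa [eq_comm] using hcard
    subst hD
    rcases Multiset.empty_or_exists_mem B with rfl | ⟨⟨o, b⟩, hB⟩
    · have hC : C = 0 := by simpa [eq_comm] using htags
      subst hC
      simpa using movable_zero
    · have hB' := Multiset.mem_map_of_mem Prod.fst hB
      refine absurd ?_ (hBC _ hB')
      rw [zero_add, add_zero] at htags
      rwa [← htags]
  have hA' : o ∈ A.map Prod.fst := Multiset.mem_map_of_mem Prod.fst hA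
  obtain ⟨⟨o', d⟩, hD⟩ : ∃ x, x ∈ D := by
    rw [← Multiset.card_pos_iff_exists_mem, ← hcard]
    exact Multiset.card_pos_iff_exists_mem.2 ⟨_, hA⟩
  have hD' : o' ∈ D.map Prod.fst := Multiset.mem_map_of_mem Prod.fst hD
  have hC' : o ∈ C.map Prod.fst := by
    have : o ∈ (C + D).map Prod.fst := by
      rw [← htags, Multiset.map_add]; exact Multiset.mem_add.2 (Or.inl hA')
    rw [Multiset.map_add, Multiset.mem_add] at this
    exact this.resolve_right (hAD o hA')
  have hB' : o' ∈ B.map Prod.fst := by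
    have : o' ∈ (A + B).map Prod.fst := by
      rw [htags, Multiset.map_add]; exact Multiset.mem_add.2 (Or.inr hD')
    rw [Multiset.map_add, Multiset.mem_add] at this
    exact this.resolve_left fun h => hAD o' h hD'
  clear hA hD hAD hBC
  obtain ⟨a, A, rfl⟩ := hcons hA'
  obtain ⟨b, B, rfl⟩ := hcons hB'
  obtain ⟨c, C, rfl⟩ := hcons hC'
  obtain ⟨d, D, rfl⟩ := hcons hD'
  have h := ih _ ?_ A B C D ?_ (by simpa using hcard) rfl
  · convert (movable_double hodd o o' c a b d).add h using 1
    · simp only [Multiset.insert_eq_cons, ← Multiset.singleton_add, Multiset.map_add,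
        Multiset.map_singleton, Prod.map, id]
      abel
    · simp only [← Multiset.singleton_add, Multiset.map_add,
        Multiset.map_singleton, Prod.map, id]
      abel
    · simp; ring
  · rw [← hN]; simp
  · simp only [Multiset.cons_add, Multiset.add_cons, Multiset.map_cons] at htags
    simpa using htags

theorem movable_of_refTags_eq (hodd : Odd n) (YE YF ZE ZF : Multiset (τ × DihedralGroup n))
    (htags : refTags (YE + YF) = refTags (ZE + ZF))
    (hnref : taggedNref (YE + ZE) = taggedNref (YF + ZF)) :
    Movable (YE + YF + ZE + ZF) (YE + YF) (taggedIdxSum (YE + ZE) - taggedIdxSum (YE + YF)) := by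
  obtain ⟨A, P, rfl⟩ := exists_tagged_decomposition YE
  obtain ⟨B, Q, rfl⟩ := exists_tagged_decomposition YF
  obtain ⟨C, R, rfl⟩ := exists_tagged_decomposition ZE
  obtain ⟨D, S, rfl⟩ := exists_tagged_decomposition ZF
  have hn : ∀ X : Multiset (τ × ZMod n), taggedNref (X.map (Prod.map id sr)) = X.card := by
    intro X; simp [taggedNref_apply, nref]
  have hn' : ∀ X : Multiset (τ × ZMod n),
      taggedNref (X.map (Prod.map id (r : ZMod n → DihedralGroup n))) = 0 := by
    intro X; simp [taggedNref_apply, nref]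
  have hi : ∀ X : Multiset (τ × ZMod n),
      taggedIdxSum (X.map (Prod.map id sr)) = (X.map Prod.snd).sum := by
    intro X; simp [taggedIdxSum_apply, idxSum]
  have hi' : ∀ X : Multiset (τ × ZMod n),
      taggedIdxSum (X.map (Prod.map id (r : ZMod n → DihedralGroup n))) = (X.map Prod.snd).sum := by
    intro X; simp [taggedIdxSum_apply, idxSum]
  simp only [map_add, refTags_map_sr, refTags_map_r, add_zero, ← Multiset.map_add] at htags
  simp only [map_add, hn, hn', add_zero] at hnref
  have hc := congrArg Multiset.card htags
  simp only [Multiset.card_map, Multiset.card_add] at hc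
  convert (movable_reflections hodd A B C D htags (by omega)).add (movable_rotations P Q R S)
    using 1
  · simp only [Multiset.map_add]; abel
  · simp only [Multiset.map_add]; abel
  · simp only [map_add, hi, hi']; ring

theorem tags_sum_card_le (M : Multiset (Move n τ)) :
    (tags (M.map Move.support).sum).card ≤ (M.map fun m => (tags m.support).card).sum := by
  induction M using Multiset.induction_on with
  | empty => simp [tags]
  | cons m M ih =>
    rw [Multiset.map_cons, Multiset.sum_cons, Multiset.map_cons, Multiset.sum_cons, tags_add]
    exact (Finset.card_union_le _ _).trans (Nat.add_le_add_left ih _)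

theorem balanced_of_le {S Y : Multiset (DihedralGroup n)} (hY : Y ≤ S)
    (hn : 2 * nref Y = nref S) (hi : 2 * idxSum Y = idxSum S) : Balanced S := by
  obtain ⟨Z, rfl⟩ := Multiset.le_iff_exists_add.1 hY
  rw [map_add] at hn hi
  exact ⟨Y, Z, rfl, by omega, by linear_combination hi⟩

/-- The terms of a tagged sequence whose tags lie in `K`. -/
def restrictTags (K : Finset τ) : Multiset (τ × DihedralGroup n) →+ Multiset (DihedralGroup n) where
  toFun t := (t.filter fun x => x.1 ∈ K).map Prod.snd
  map_zero' := by simp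
  map_add' := by simp

theorem restrictTags_apply (K : Finset τ) (t : Multiset (τ × DihedralGroup n)) :
    restrictTags K t = (t.filter fun x => x.1 ∈ K).map Prod.snd := rfl

theorem restrictTags_mono (K : Finset τ) {s t : Multiset (τ × DihedralGroup n)} (h : s ≤ t) :
    restrictTags K s ≤ restrictTags K t :=
  Multiset.map_le_map (Multiset.filter_le_filter _ h)

theorem restrictTags_eq_map_snd {K : Finset τ} {t : Multiset (τ × DihedralGroup n)}
    (h : tags t ⊆ K) : restrictTags K t = t.map Prod.snd := by
  have : (t.filter fun x => x.1 ∈ K) = t := by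
    rw [Multiset.filter_eq_self]
    intro x hx
    exact h (by simpa [tags] using ⟨x.2, hx⟩)
  exact congrArg (Multiset.map Prod.snd) this

theorem restrictTags_sum_map_mk [Fintype τ] (K : Finset τ)
    (X : τ → Multiset (DihedralGroup n)) :
    restrictTags K (∑ o, (X o).map (Prod.mk o)) = ∑ o ∈ K, X o := by
  rw [map_sum, ← Finset.sum_subset (Finset.subset_univ K)]
  · refine Finset.sum_congr rfl fun o ho => ?_
    simp [restrictTags_apply, Multiset.filter_map, ho]
  · intro o _ ho
    simp [restrictTags_apply, Multiset.filter_map, ho]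

theorem sum_map_le_sum_map {α β : Type*} {f g : α → Multiset β} (h : ∀ a, f a ≤ g a)
    (M : Multiset α) : (M.map f).sum ≤ (M.map g).sum := by
  induction M using Multiset.induction_on with
  | empty => simp
  | cons a M ih => simpa using add_le_add (h a) ih

theorem Movable.exists_tags [NeZero n] {s p : Multiset (τ × DihedralGroup n)} {ε : ZMod n}
    (h : Movable s p ε) : ∃ J : Finset τ, J.card ≤ n ∧ ∀ K, J ⊆ K →
      ∃ q ≤ restrictTags K s, nref q = nref (restrictTags K p) ∧
        idxSum q = idxSum (restrictTags K p) + ε := by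
  obtain ⟨M, rfl, rfl, rfl⟩ := h
  obtain ⟨A, B, C, rfl, hsum, hc⟩ := exists_cheap_choice
    (fun m : Move n τ => taggedIdxSum m.first - taggedIdxSum m.base)
    (fun m => taggedIdxSum m.second - taggedIdxSum m.base) (fun m => (tags m.support).card) M
    (fun m _ => m.cheap)
  rw [Nat.card_zmod] at hc
  refine ⟨tags ((B + C).map Move.support).sum, (tags_sum_card_le _).trans hc, fun K hK => ?_⟩
  have htag : ∀ N ≤ B + C, ∀ f : Move n τ → Multiset (τ × DihedralGroup n),
      (∀ m, f m ≤ m.support) → restrictTags K (N.map f).sum = (N.map f).sum.map Prod.snd := by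
    intro N hN f hf
    refine restrictTags_eq_map_snd (subset_trans ?_ hK)
    obtain ⟨N', hN'⟩ := Multiset.le_iff_exists_add.1 hN
    have h1 : (N.map f).sum ≤ ((B + C).map Move.support).sum := by
      rw [hN', Multiset.map_add, Multiset.sum_add]
      exact (sum_map_le_sum_map hf N).trans (Multiset.le_add_right _ _)
    exact Multiset.toFinset_subset.2 (Multiset.subset_of_le (Multiset.map_le_map h1))
  have hB : B ≤ B + C := Multiset.le_add_right _ _
  have hC : C ≤ B + C := Multiset.le_add_left _ _
  have hnref : ∀ (N : Multiset (Move n τ)) (f : Move n τ → Multiset (τ × DihedralGroup n)),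
      (∀ m, taggedNref (f m) = taggedNref m.base) →
      taggedNref (N.map f).sum = taggedNref (N.map Move.base).sum := by
    intro N f hf
    simp only [map_multiset_sum, Multiset.map_map, Function.comp_def, hf]
  have hidx : ∀ (N : Multiset (Move n τ)) (f : Move n τ → Multiset (τ × DihedralGroup n)),
      taggedIdxSum (N.map f).sum = taggedIdxSum (N.map Move.base).sum +
        (N.map fun m => taggedIdxSum (f m) - taggedIdxSum m.base).sum := by
    intro N f
    simp only [map_multiset_sum, Multiset.map_map, Function.comp_def, Multiset.sum_map_sub]
    abel
  refine ⟨restrictTags K ((A.map Move.base).sum + (B.map Move.first).sum +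
    (C.map Move.second).sum), restrictTags_mono K ?_, ?_, ?_⟩
  · simp only [Multiset.map_add, Multiset.sum_add]
    exact add_le_add (add_le_add (sum_map_le_sum_map Move.base_le _)
      (sum_map_le_sum_map Move.first_le _)) (sum_map_le_sum_map Move.second_le _)
  · simp only [Multiset.map_add, Multiset.sum_add, map_add, htag B hB _ Move.first_le,
      htag C hC _ Move.second_le, htag B hB _ Move.base_le, htag C hC _ Move.base_le,
      ← taggedNref_apply, hnref B _ Move.nref_first, hnref C _ Move.nref_second]
  · rw [← hsum]
    simp only [Multiset.map_add, Multiset.sum_add, map_add, htag B hB _ Move.first_le,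
      htag C hC _ Move.second_le, htag B hB _ Move.base_le, htag C hC _ Move.base_le,
      ← taggedIdxSum_apply, hidx B Move.first, hidx C Move.second]
    abel

/-- If `X o` is balanced for all `o ≠ o₀` and the whole family is balanced, then adding at most
`n` of the other members to `X o₀` already gives a balanced sequence. -/
theorem exists_balanced_subfamily [NeZero n] [Fintype τ] (hodd : Odd n) (o₀ : τ)
    (X : τ → Multiset (DihedralGroup n)) (hX : ∀ o, o ≠ o₀ → Balanced (X o))
    (h₀ : Even (nref (X o₀))) (htot : Balanced (∑ o, X o)) :
    ∃ J : Finset τ, o₀ ∉ J ∧ J.card ≤ n ∧ Balanced (X o₀ + ∑ o ∈ J, X o) := by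
  have hsplit : ∀ o, ∃ Y Z, Y + Z = X o ∧ nref Y = nref Z ∧
      (o ≠ o₀ → idxSum Y = idxSum Z) := by
    intro o
    by_cases ho : o = o₀
    · subst ho
      obtain ⟨A, R, hAR⟩ := exists_eq_map_sr_add_map_r (X o)
      rw [hAR] at h₀
      simp only [map_add, nref_map_sr, nref_map_r, add_zero] at h₀
      obtain ⟨k, hk⟩ := h₀
      obtain ⟨A₁, A₂, rfl, hA₁⟩ := exists_add_card_eq (s := A) (k := k) (by omega)
      rw [Multiset.card_add] at hk
      refine ⟨A₁.map sr, A₂.map sr + R.map r, by rw [hAR, Multiset.map_add]; abel, ?_, by simp⟩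
      simp only [map_add, nref_map_sr, nref_map_r]
      omega
    · obtain ⟨Y, Z, h1, h2, h3⟩ := hX o ho
      exact ⟨Y, Z, h1, h2, fun _ => h3⟩
  choose Y Z hYZ hn hi using hsplit
  obtain ⟨E, F, hEF, hEFn, hEFi⟩ := htot
  have hsnd : ∀ V : τ → Multiset (DihedralGroup n),
      (∑ o, (V o).map (Prod.mk o)).map Prod.snd = ∑ o, V o := by
    intro V
    rw [← Multiset.coe_mapAddMonoidHom, map_sum]
    simp
  have hadd : ∑ o, (X o).map (Prod.mk o) =
      ∑ o, (Y o).map (Prod.mk o) + ∑ o, (Z o).map (Prod.mk o) := by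
    simp only [← hYZ, Multiset.map_add, Finset.sum_add_distrib]
  obtain ⟨E', F', hEF', rfl, rfl⟩ := exists_add_of_map_eq_add ((hsnd X).trans hEF.symm)
  obtain ⟨YE, YF, ZE, ZF, hY, hZ, rfl, rfl⟩ := exists_refinement (hadd.symm.trans hEF')
  have hmov := movable_of_refTags_eq hodd YE YF ZE ZF (by
    rw [hY, hZ, map_sum, map_sum]
    exact Finset.sum_congr rfl fun o _ => by rw [refTags_map_mk, refTags_map_mk, hn]) hEFn
  rw [add_assoc, hY, hZ, ← hadd] at hmov
  obtain ⟨J, hJ, hJK⟩ := hmov.exists_tags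
  refine ⟨J.erase o₀, Finset.notMem_erase _ _,
    (Finset.card_le_card (Finset.erase_subset _ _)).trans hJ, ?_⟩
  obtain ⟨q, hq, hqn, hqi⟩ := hJK (insert o₀ J) (Finset.subset_insert _ _)
  have hJe : X o₀ + ∑ o ∈ J.erase o₀, X o = ∑ o ∈ insert o₀ J, X o := by
    rw [← Finset.sum_insert (Finset.notMem_erase o₀ J), show insert o₀ (J.erase o₀) = insert o₀ J by
      ext o; by_cases h : o = o₀ <;> simp [h]]
  simp only [restrictTags_sum_map_mk] at hq hqn hqi
  rw [hJe]
  refine balanced_of_le hq ?_ ?_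
  · rw [hqn]
    simp only [map_sum, ← hYZ, map_add, hn, Finset.sum_add_distrib]
    ring
  · have htot : 2 * taggedIdxSum (YE + ZE) = ∑ o, idxSum (Y o) + ∑ o, idxSum (Z o) := by
      rw [← map_sum, ← map_sum, ← hsnd Y, ← hsnd Z, ← hY, ← hZ, ← taggedIdxSum_apply,
        ← taggedIdxSum_apply]
      rw [← taggedIdxSum_apply, ← taggedIdxSum_apply] at hEFi
      simp only [map_add] at hEFi ⊢
      linear_combination hEFi
    have hdiff : ∑ o, (idxSum (Z o) - idxSum (Y o)) =
        ∑ o ∈ insert o₀ J, (idxSum (Z o) - idxSum (Y o)) := by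
      refine (Finset.sum_subset (Finset.subset_univ _) fun o _ ho => ?_).symm
      rw [hi o fun h => ho (by simp [h]), sub_self]
    simp only [Finset.sum_sub_distrib] at hdiff
    rw [hqi, taggedIdxSum_apply (∑ o, _), hsnd Y]
    simp only [map_sum, ← hYZ, map_add, Finset.sum_add_distrib] at htot ⊢
    linear_combination htot + hdiff

end Moves

end ProductOne

namespace ProductOne

open DihedralGroup

section Distance

variable {n : ℕ}

theorem mul_card_le_card_sum {α : Type*} {f : Multiset (Multiset α)} {c : ℕ}
    (h : ∀ U ∈ f, c ≤ U.card) : c * f.card ≤ f.sum.card := by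
  induction f using Multiset.induction_on with
  | empty => simp
  | cons U f ih =>
    have h1 := ih fun V hV => h V (Multiset.mem_cons_of_mem hV)
    have h2 := h U (Multiset.mem_cons_self _ _)
    rw [Multiset.card_cons, Multiset.sum_cons, Multiset.card_add, mul_add]
    omega

theorem exists_balanced_part [NeZero n] (hodd : Odd n) {W : Multiset (DihedralGroup n)}
    {h : Multiset (Multiset (DihedralGroup n))} (hh : ∀ V ∈ h, Balanced V) (hW : Even (nref W))
    (htot : Balanced (W + h.sum)) : ∃ J ≤ h, J.card ≤ n ∧ Balanced (W + J.sum) := by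
  classical
  obtain ⟨l, rfl⟩ := Quot.exists_rep h
  obtain ⟨J, hJ0, hJ, hbal⟩ := exists_balanced_subfamily (τ := Option (Fin l.length)) hodd none
    (fun o => o.elim W l.get) (by
      rintro (_ | i) ho
      · exact absurd rfl ho
      · exact hh _ (by simp)) hW (by
      rw [Fintype.sum_option]
      simpa [Finset.sum, Fin.univ_val_map] using htot)
  refine ⟨J.eraseNone.val.map l.get, ?_, ?_, ?_⟩
  · refine (Multiset.map_le_map (Finset.val_le_iff.2 (Finset.subset_univ _))).trans ?_
    simp [Fin.univ_val_map]
  · rw [Multiset.card_map, Finset.card_val]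
    rw [← Finset.card_map Function.Embedding.some, Finset.map_some_eraseNone]
    exact (Finset.card_le_card (Finset.erase_subset _ _)).trans hJ
  · rw [← Finset.erase_eq_of_notMem hJ0, ← Finset.map_some_eraseNone, Finset.sum_map] at hbal
    exact hbal

theorem IsProductOne.even_nref {S : Multiset (DihedralGroup n)} (h : IsProductOne S) :
    Even (nref S) := by
  obtain ⟨Y, Z, rfl, hn, -⟩ := h.balanced
  exact ⟨nref Z, by rw [map_add, hn]⟩

theorem exists_isProductOne_part [NeZero n] (hodd : Odd n) {W : Multiset (DihedralGroup n)}
    {h : Multiset (Multiset (DihedralGroup n))} (hh : ∀ V ∈ h, IsProductOne V)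
    (htot : IsProductOne (W + h.sum)) : ∃ J ≤ h, J.card ≤ n + 1 ∧ IsProductOne (W + J.sum) := by
  have hW : Even (nref W) := by
    have h1 := htot.even_nref
    have h2 := (isProductOne_sum hh).even_nref
    rw [map_add] at h1
    exact (Nat.even_add.1 h1).2 h2
  by_cases hW0 : nref W = 0
  swap
  · obtain ⟨J, hJ, hJc, hJb⟩ :=
      exists_balanced_part hodd (fun V hV => (hh V hV).balanced) hW htot.balanced
    exact ⟨J, hJ, by omega, hJb.isProductOne (by simp [hW0])⟩
  by_cases hr : ∃ V ∈ h, nref V ≠ 0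
  · obtain ⟨V, hV, hV0⟩ := hr
    obtain ⟨h, rfl⟩ := Multiset.exists_cons_of_mem hV
    rw [Multiset.sum_cons, ← add_assoc] at htot
    obtain ⟨J, hJ, hJc, hJb⟩ := exists_balanced_part hodd
      (fun V' hV' => (hh V' (Multiset.mem_cons_of_mem hV')).balanced)
      (by rw [map_add]; exact hW.add (hh V hV).even_nref) htot.balanced
    refine ⟨V ::ₘ J, Multiset.cons_le_cons V hJ, by simpa using hJc, ?_⟩
    rw [Multiset.sum_cons, ← add_assoc]
    exact hJb.isProductOne (by simp [hV0])
  · push Not at hr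
    have hn : nref h.sum = 0 := by
      rw [map_multiset_sum]
      exact Multiset.sum_eq_zero (by simpa using hr)
    refine ⟨0, Multiset.zero_le _, by simp, ?_⟩
    rw [isProductOne_iff_of_nref_eq_zero (by simp [hW0, hn])] at htot
    have := (isProductOne_iff_of_nref_eq_zero hn).1 (isProductOne_sum hh)
    rw [isProductOne_iff_of_nref_eq_zero (by simpa using hW0)]
    simpa [this] using htot

theorem exists_small_subfamily [NeZero n] (hodd : Odd n) {U C : Multiset (DihedralGroup n)}
    (hU : U.card ≤ n) (hUp : IsProductOne U) (hC : IsProductOne C)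
    {g : Multiset (Multiset (DihedralGroup n))} (hg : ∀ V ∈ g, IsProductOne V)
    (hsum : g.sum = U + C) :
    ∃ g₁ ≤ g, g₁.card ≤ 2 * n ∧ ∃ C', IsProductOne C' ∧ g₁.sum = U + C' := by
  classical
  obtain ⟨p, rfl, rfl, rfl⟩ := exists_distribution g hsum
  set a := p.filter fun x => x.1 ≠ 0
  set b := p.filter fun x => ¬ x.1 ≠ 0
  have hab : a + b = p := Multiset.filter_add_not _ _
  have hb0 : ∀ x ∈ b, x.1 = 0 := fun x hx => by simpa using (Multiset.mem_filter.1 hx).2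
  have ha0 : ∀ x ∈ a, x.1 ≠ 0 := fun x hx => (Multiset.mem_filter.1 hx).2
  have hbs : (b.map Prod.fst).sum = 0 := Multiset.sum_eq_zero (by
    intro y hy
    obtain ⟨x, hx, rfl⟩ := Multiset.mem_map.1 hy
    exact hb0 x hx)
  clear_value a b
  subst hab
  have hbm : b.map (fun x => x.1 + x.2) = b.map Prod.snd :=
    Multiset.map_congr rfl fun x hx => by rw [hb0 x hx, zero_add]
  simp only [Multiset.map_add, Multiset.sum_add, hbs, add_zero] at hU hUp hC ⊢
  have hac : a.card ≤ (a.map Prod.fst).sum.card := by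
    simpa using mul_card_le_card_sum (f := a.map Prod.fst) (c := 1) (by
      intro y hy
      obtain ⟨x, hx, rfl⟩ := Multiset.mem_map.1 hy
      exact Multiset.card_pos.2 (ha0 x hx))
  have hadd : (a.map fun x => x.1 + x.2).sum = (a.map Prod.fst).sum + (a.map Prod.snd).sum :=
    Multiset.sum_map_add
  rcases hac.lt_or_eq with hlt | heq
  · obtain ⟨J, hJ, hJc, hJp⟩ := exists_isProductOne_part hodd (h := b.map Prod.snd) (by
      intro V hV
      rw [← hbm] at hV
      exact hg V (by rw [Multiset.map_add]; exact Multiset.mem_add.2 (Or.inr hV))) hC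
    refine ⟨a.map (fun x => x.1 + x.2) + J, ?_, ?_, _, hJp, ?_⟩
    · rw [hbm]
      exact add_le_add le_rfl hJ
    · rw [Multiset.card_add, Multiset.card_map]; omega
    · rw [Multiset.sum_add, hadd, add_assoc]
  · refine ⟨a.map (fun x => x.1 + x.2), Multiset.le_add_right _ _, ?_, _, ?_, hadd⟩
    · rw [Multiset.card_map]; omega
    · have hone : ∀ x ∈ a, ∃ t, x.1 = {t} := by
        intro x hx
        rw [← Multiset.card_eq_one]
        obtain ⟨a', rfl⟩ := Multiset.exists_cons_of_mem hx
        have h1 : a'.card ≤ (a'.map Prod.fst).sum.card := by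
          simpa using mul_card_le_card_sum (f := a'.map Prod.fst) (c := 1) (by
            intro y hy
            obtain ⟨x, hx, rfl⟩ := Multiset.mem_map.1 hy
            exact Multiset.card_pos.2 (ha0 x (Multiset.mem_cons_of_mem hx)))
        have h2 := Multiset.card_pos.2 (ha0 x hx)
        rw [Multiset.map_cons, Multiset.sum_cons, Multiset.card_add, Multiset.card_cons] at heq
        omega
      obtain ⟨q, rfl⟩ : ∃ q : Multiset (DihedralGroup n × Multiset (DihedralGroup n)),
          a = q.map fun y => ({y.1}, y.2) := by
        clear * - hone
        induction a using Multiset.induction_on with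
        | empty => exact ⟨0, by simp⟩
        | cons x a ih =>
          obtain ⟨q, rfl⟩ := ih fun y hy => hone y (Multiset.mem_cons_of_mem hy)
          obtain ⟨t, ht⟩ := hone x (Multiset.mem_cons_self _ _)
          exact ⟨(t, x.2) ::ₘ q, by rw [Multiset.map_cons, ← ht]⟩
      rw [Multiset.map_map]
      refine isProductOne_sum_snd (h := q) ?_ ?_
      · intro x hx
        exact hg _ (by
          simp only [Multiset.map_add, Multiset.map_map, Multiset.mem_add, Multiset.mem_map]
          exact Or.inl ⟨x, hx, rfl⟩)
      · rw [Multiset.map_map] at hUp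
        have : (q.map fun y => ({y.1} : Multiset (DihedralGroup n))).sum = q.map Prod.fst := by
          clear * -
          induction q using Multiset.induction_on with
          | empty => simp
          | cons x q ih => simp [ih]
        rw [← this]
        exact hUp

theorem IsFactorization.isProductOne {G : Type*} [Group G] {A : Multiset G}
    {f : Multiset (Multiset G)} (h : IsFactorization A f) : IsProductOne A :=
  h.2 ▸ isProductOne_sum fun U hU => (h.1 U hU).isProductOne

theorem IsFactorization.add {G : Type*} [Group G] {A B : Multiset G}
    {f g : Multiset (Multiset G)} (hf : IsFactorization A f) (hg : IsFactorization B g) :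
    IsFactorization (A + B) (f + g) := by
  refine ⟨fun U hU => ?_, by rw [Multiset.sum_add, hf.2, hg.2]⟩
  rcases Multiset.mem_add.1 hU with h | h
  exacts [hf.1 U h, hg.1 U h]

theorem isFactorization_singleton {G : Type*} [Group G] {U : Multiset G} (h : IsAtomSeq U) :
    IsFactorization U {U} := ⟨by simpa using h, by simp⟩

theorem isFactorization_cons {G : Type*} [Group G] {A U : Multiset G}
    {f : Multiset (Multiset G)} (h : IsFactorization A (U ::ₘ f)) :
    IsAtomSeq U ∧ ∃ B, A = U + B ∧ IsFactorization B f :=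
  ⟨h.1 U (Multiset.mem_cons_self _ _), f.sum, by rw [← h.2, Multiset.sum_cons],
    fun V hV => h.1 V (Multiset.mem_cons_of_mem hV), rfl⟩

theorem IsFactorization.two_mul_card_le {G : Type*} [Group G] {A : Multiset G}
    {f : Multiset (Multiset G)} (h : IsFactorization A f) (h1 : (1 : G) ∉ A) :
    2 * f.card ≤ A.card := by
  rw [← h.2] at h1 ⊢
  refine mul_card_le_card_sum fun U hU => (h.1 U hU).two_le_card fun h' => h1 ?_
  exact Multiset.mem_of_le (Multiset.le_sum_of_mem hU) h'

/-- Two atoms with many reflections in a factorization can be refactored to get a short atom. -/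
theorem exists_short_atom [NeZero n] (hn : 3 ≤ n) (hodd : Odd n)
    {U V : Multiset (DihedralGroup n)} (hU : IsAtomSeq U) (hV : IsAtomSeq V) :
    ∃ T f, T ∈ f ∧ T.card ≤ n ∧ IsFactorization (U + V) f := by
  by_cases hshort : U.card ≤ n ∨ V.card ≤ n
  · have hf := (isFactorization_singleton hU).add (isFactorization_singleton hV)
    rcases hshort with h | h
    · exact ⟨U, _, by simp, h, hf⟩
    · exact ⟨V, _, by simp, h, hf⟩
  have hpos : ∀ X : Multiset (DihedralGroup n), IsAtomSeq X → ¬ X.card ≤ n → 2 ≤ nref X := by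
    intro X hX hXn
    by_contra hlt
    obtain ⟨k, hk⟩ := hX.isProductOne.even_nref
    exact hXn (hX.card_le_of_nref_eq_zero (by omega))
  push Not at hshort
  have h1 := hpos U hU (by omega)
  have h2 := hpos V hV (by omega)
  obtain ⟨Y, Z, hYZ, hnref, hidx⟩ := (hU.isProductOne.add hV.isProductOne).balanced
  have h3 := congrArg nref hYZ
  have h4 := congrArg Multiset.card hYZ
  rw [map_add, map_add] at h3
  rw [Multiset.card_add, Multiset.card_add] at h4
  obtain ⟨T, C, hTC, hT0, hTn, hT, hC⟩ :=
    hasShortPart_add hn hodd hnref hidx (by omega) (by omega)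
  obtain ⟨f, hf⟩ := hT.exists_atoms
  obtain ⟨g, hg⟩ := hC.exists_atoms
  have hf0 : f ≠ 0 := by
    rintro rfl
    exact hT0 (by simpa using hf.2.symm)
  obtain ⟨X, hX⟩ := Multiset.exists_mem_of_ne_zero hf0
  refine ⟨X, f + g, Multiset.mem_add.2 (Or.inl hX), ?_, ?_⟩
  · refine (Multiset.card_le_card ?_).trans hTn
    rw [← hf.2]
    exact Multiset.le_sum_of_mem hX
  · rw [← hYZ, ← hTC]
    exact IsFactorization.add hf hg

theorem mem_of_one_mem {G : Type*} [Group G] {A : Multiset G} {f : Multiset (Multiset G)}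
    (h : IsFactorization A f) (h1 : (1 : G) ∈ A) : {1} ∈ f := by
  rw [← h.2] at h1
  obtain ⟨U, hU, hU1⟩ := Multiset.mem_join.1 h1
  rwa [← (h.1 U hU).eq_singleton_one hU1]

theorem gap_le [NeZero n] (hn : 3 ≤ n) (hodd : Odd n) (A : Multiset (DihedralGroup n)) (k l : ℕ)
    (hkl : k < l) (hlow : ∃ f, IsFactorization A f ∧ f.card ≤ k)
    (hhigh : ∃ g, IsFactorization A g ∧ l ≤ g.card)
    (hgap : ∀ f, IsFactorization A f → f.card ≤ k ∨ l ≤ f.card) : l + 2 ≤ k + 2 * n := by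
  induction hN : A.card using Nat.strong_induction_on generalizing A k l with
  | _ N ih =>
  by_contra hlarge
  have hcommon : ∀ U f g, IsFactorization A f → IsFactorization A g → f.card ≤ k → l ≤ g.card →
      U ∈ f → U ∈ g → False := by
    intro U f g hf hg hfk hgl hUf hUg
    obtain ⟨f, rfl⟩ := Multiset.exists_cons_of_mem hUf
    obtain ⟨g, rfl⟩ := Multiset.exists_cons_of_mem hUg
    obtain ⟨hU, B, rfl, hfB⟩ := isFactorization_cons hf
    obtain ⟨-, B', hBB', hgB⟩ := isFactorization_cons hg
    obtain rfl : B = B' := add_left_cancel hBB'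
    rw [Multiset.card_cons] at hfk hgl
    have := ih B.card (by rw [← hN, Multiset.card_add]; have := hU.card_pos; omega) B (k - 1)
      (l - 1) (by omega) ⟨f, hfB, by omega⟩ ⟨g, hgB, by omega⟩ (fun h hh => by
        have := hgap _ ((isFactorization_singleton hU).add hh)
        rw [Multiset.card_add, Multiset.card_singleton] at this
        omega) rfl
    omega
  obtain ⟨f, hf, hfk⟩ := hlow
  obtain ⟨g, hg, hgl⟩ := hhigh
  have h1 : (1 : DihedralGroup n) ∉ A := fun h =>
    hcommon _ f g hf hg hfk hgl (mem_of_one_mem hf h) (mem_of_one_mem hg h)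
  obtain ⟨T, f', hT, hTn, hf', hfk'⟩ : ∃ T f', T ∈ f' ∧ T.card ≤ n ∧ IsFactorization A f' ∧
      f'.card ≤ k := by
    rcases Multiset.empty_or_exists_mem f with rfl | ⟨U, hU⟩
    · exfalso
      have hA : A = 0 := by simpa using hf.2.symm
      have := hg.two_mul_card_le h1
      rw [hA, Multiset.card_zero] at this
      omega
    obtain ⟨f, rfl⟩ := Multiset.exists_cons_of_mem hU
    obtain ⟨hUa, B, rfl, hfB⟩ := isFactorization_cons hf
    rcases Multiset.empty_or_exists_mem f with rfl | ⟨V, hV⟩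
    · exfalso
      have hB : B = 0 := by simpa using hfB.2.symm
      rw [hB, add_zero] at hg
      have := eq_singleton_of_sum_eq_atom hg.1 hUa hg.2
      rw [this, Multiset.card_singleton] at hgl
      simp only [Multiset.card_cons, Multiset.card_zero] at hfk
      omega
    obtain ⟨f, rfl⟩ := Multiset.exists_cons_of_mem hV
    obtain ⟨hVa, B, rfl, hfB'⟩ := isFactorization_cons hfB
    obtain ⟨T, h, hTh, hTn, hh⟩ := exists_short_atom hn hodd hUa hVa
    have hhB := hh.add hfB'
    rw [add_assoc] at hhB
    refine ⟨T, h + f, Multiset.mem_add.2 (Or.inl hTh), hTn, hhB, (hgap _ hhB).resolve_right ?_⟩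
    have hc := hh.two_mul_card_le fun h => h1 (by
      rw [← add_assoc]; exact Multiset.mem_add.2 (Or.inl h))
    have hUc := hUa.card_le
    have hVc := hVa.card_le
    rw [DihedralGroup.nat_card] at hUc hVc
    rw [Multiset.card_add] at hc ⊢
    simp only [Multiset.card_cons] at hfk
    omega
  have hTa := hf'.1 T hT
  obtain ⟨f'', rfl⟩ := Multiset.exists_cons_of_mem hT
  obtain ⟨-, C, rfl, hC⟩ := isFactorization_cons hf'
  obtain ⟨g₁, hg₁, hg₁c, C', hC', hsum⟩ := exists_small_subfamily hodd hTn hTa.isProductOne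
    hC.isProductOne (fun V hV => (hg.1 V hV).isProductOne) hg.2
  obtain ⟨g₂, rfl⟩ := Multiset.le_iff_exists_add.1 hg₁
  have hg₁a : ∀ V ∈ g₁, IsAtomSeq V := fun V hV => hg.1 V (Multiset.mem_add.2 (Or.inl hV))
  have hg₂a : ∀ V ∈ g₂, IsAtomSeq V := fun V hV => hg.1 V (Multiset.mem_add.2 (Or.inr hV))
  by_cases hC0 : C' = 0
  · rw [hC0, add_zero] at hsum
    have := eq_singleton_of_sum_eq_atom hg₁a hTa hsum
    exact hcommon T _ _ hf' hg hfk' hgl hT (by simp [this])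
  obtain ⟨h, hh⟩ := hC'.exists_atoms
  have hh0 : 0 < h.card := by
    rw [Multiset.card_pos]
    rintro rfl
    exact hC0 (by simpa using hh.2.symm)
  have hnew : IsFactorization (T + C) ({T} + h + g₂) := by
    have := ((isFactorization_singleton hTa).add hh).add (⟨hg₂a, rfl⟩ : IsFactorization _ g₂)
    rwa [← hsum, ← Multiset.sum_add, hg.2] at this
  refine hcommon T _ _ hf' hnew hfk' ((hgap _ hnew).resolve_left ?_) hT (by simp)
  rw [Multiset.card_add] at hgl
  simp only [Multiset.card_add, Multiset.card_singleton]
  omega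

end Distance

end ProductOne

namespace ProductOne

open DihedralGroup

section Family

variable {n : ℕ}

/-- The sequence consisting of `x` copies of `r 1`, `y` copies of `sr 0` and `z` copies
of `sr 1`. -/
def triple (n x y z : ℕ) : Multiset (DihedralGroup n) :=
  x • {r 1} + y • {sr 0} + z • {sr 1}

theorem triple_add (x y z x' y' z' : ℕ) :
    triple n x y z + triple n x' y' z' = triple n (x + x') (y + y') (z + z') := by
  simp only [triple, add_smul]; abel

theorem nref_triple (x y z : ℕ) : nref (triple n x y z) = y + z := by
  simp [triple, map_nsmul]

theorem idxSum_triple (x y z : ℕ) : idxSum (triple n x y z) = (x : ZMod n) + z := by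
  simp [triple, map_nsmul]

/-- The number of copies of `r 1`. -/
def numX : Multiset (DihedralGroup n) →+ ℕ := Multiset.countAddMonoidHom (r 1)

/-- The number of copies of `sr 0`. -/
def numY : Multiset (DihedralGroup n) →+ ℕ := Multiset.countAddMonoidHom (sr 0)

/-- The number of copies of `sr 1`. -/
def numZ : Multiset (DihedralGroup n) →+ ℕ := Multiset.countAddMonoidHom (sr 1)

theorem count_triple (x y z : ℕ) (g : DihedralGroup n) :
    (triple n x y z).count g = (if g = r 1 then x else 0) + (if g = sr 0 then y else 0) +
      if g = sr 1 then z else 0 := by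
  simp [triple, Multiset.count_singleton]

theorem sr_zero_ne_sr_one (hn : 3 ≤ n) : (sr 0 : DihedralGroup n) ≠ sr 1 := by
  have : Fact (1 < n) := ⟨by omega⟩
  simp

theorem numX_triple (x y z : ℕ) : numX (triple n x y z) = x := by
  simp [numX, count_triple]

theorem numY_triple (hn : 3 ≤ n) (x y z : ℕ) : numY (triple n x y z) = y := by
  simp [numY, count_triple, sr_zero_ne_sr_one hn]

theorem numZ_triple (hn : 3 ≤ n) (x y z : ℕ) : numZ (triple n x y z) = z := by
  simp [numZ, count_triple, (sr_zero_ne_sr_one hn).symm]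

theorem eq_triple_of_le (hn : 3 ≤ n) {S : Multiset (DihedralGroup n)} {x y z : ℕ}
    (h : S ≤ triple n x y z) : S = triple n (numX S) (numY S) (numZ S) := by
  ext g
  have hle := Multiset.le_iff_count.1 h g
  rw [count_triple] at hle ⊢
  by_cases hx : g = r 1
  · subst hx; simp [numX]
  by_cases hy : g = sr 0
  · subst hy; simp [numY, sr_zero_ne_sr_one hn]
  by_cases hz : g = sr 1
  · subst hz; simp [numZ, (sr_zero_ne_sr_one hn).symm]
  simpa [hx, hy, hz] using hle

theorem even_of_isProductOne_triple {x y z : ℕ} (h : IsProductOne (triple n x y z)) :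
    Even (y + z) := nref_triple (n := n) x y z ▸ h.even_nref

theorem le_of_isProductOne_triple (hn : 3 ≤ n) {x y z : ℕ} (h : IsProductOne (triple n x y z))
    (hodd : Odd (x + z)) : n ≤ x + min y z := by
  obtain ⟨P, Q, hPQ, hnref, hidx⟩ := h.balanced
  have hP := eq_triple_of_le hn (hPQ ▸ Multiset.le_add_right P Q)
  have hQ := eq_triple_of_le hn (hPQ ▸ Multiset.le_add_left Q P)
  have hx := congrArg numX hPQ
  have hy := congrArg numY hPQ
  have hz := congrArg numZ hPQ
  rw [map_add, numX_triple] at hx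
  rw [map_add, numY_triple hn] at hy
  rw [map_add, numZ_triple hn] at hz
  rw [hP, hQ, nref_triple, nref_triple] at hnref
  rw [hP, hQ, idxSum_triple, idxSum_triple] at hidx
  generalize numX P = x₁, numX Q = x₂, numY P = y₁, numY Q = y₂, numZ P = z₁, numZ Q = z₂ at *
  have hdvd : (n : ℤ) ∣ (x₁ + z₁) - (x₂ + z₂) := by
    rw [← ZMod.intCast_zmod_eq_zero_iff_dvd]
    push_cast
    rw [hidx, sub_self]
  have hne : ((x₁ : ℤ) + z₁) - (x₂ + z₂) ≠ 0 := by
    obtain ⟨k, hk⟩ := hodd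
    omega
  have := Int.le_of_dvd (abs_pos.2 hne) ((dvd_abs _ _).2 hdvd)
  rcases abs_cases (((x₁ : ℤ) + z₁) - (x₂ + z₂)) with h | h <;> omega

theorem isProductOne_triple {x y z : ℕ} (hxz : Even (x + z)) (hyz : Even (y + z))
    (hpos : 0 < y + z) : IsProductOne (triple n x y z) := by
  refine Balanced.isProductOne ?_ (by rw [nref_triple]; omega)
  rcases Nat.even_or_odd z with hz | hz
  · obtain ⟨a, rfl⟩ := (Nat.even_add.1 hxz).2 hz
    obtain ⟨b, rfl⟩ := (Nat.even_add.1 hyz).2 hz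
    obtain ⟨c, rfl⟩ := hz
    exact ⟨triple n a b c, triple n a b c, triple_add .., rfl, rfl⟩
  · obtain ⟨a, rfl⟩ := (Nat.even_add'.1 hxz).2 hz
    obtain ⟨b, rfl⟩ := (Nat.even_add'.1 hyz).2 hz
    obtain ⟨c, rfl⟩ := hz
    refine ⟨triple n a b (c + 1), triple n (a + 1) (b + 1) c, ?_, ?_, ?_⟩
    · rw [triple_add]; congr 1 <;> omega
    · rw [nref_triple, nref_triple]; omega
    · rw [idxSum_triple, idxSum_triple]; push_cast; ring

theorem eq_two_of_isAtomSeq_triple (hodd : Odd n) {x y z : ℕ}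
    (h : IsAtomSeq (triple n x y z)) (hx : x < 2 * n) (hxz : Even (x + z)) : y + z = 2 := by
  have hyz := even_of_isProductOne_triple h.isProductOne
  have hsplit : ∀ y' z', triple n x y z = triple n 0 y' z' + triple n x (y - y') (z - z') →
      Even y' → Even z' → y' + z' = 2 → y' ≤ y → z' ≤ z → 4 ≤ y + z → False := by
    intro y' z' heq hy' hz' h2 hyy hzz h4
    rcases h.2.2 _ _ heq (isProductOne_triple (by simpa using hz') (hy'.add hz') (by omega))
      (isProductOne_triple (by grind) (by grind) (by omega)) with h0 | h0
    · have := congrArg nref h0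
      rw [nref_triple, map_zero] at this
      omega
    · have := congrArg nref h0
      rw [nref_triple, map_zero] at this
      omega
  by_contra hne
  rcases Nat.eq_zero_or_pos (y + z) with h0 | hpos
  · have hnz : nref (triple n x y z) = 0 := by rw [nref_triple, h0]
    have hidx := (isProductOne_iff_of_nref_eq_zero hnz).1 h.isProductOne
    obtain ⟨rfl, rfl⟩ : y = 0 ∧ z = 0 := by omega
    rw [idxSum_triple, Nat.cast_zero, add_zero, ZMod.natCast_eq_zero_iff] at hidx
    obtain ⟨c, rfl⟩ := hidx
    have hc : c < 2 := by nlinarith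
    have hpos : 0 < c := by
      rcases Nat.eq_zero_or_pos c with rfl | hc0
      · exact absurd (by simp [triple]) h.1
      · exact hc0
    obtain rfl : c = 1 := by omega
    rw [mul_one, add_zero] at hxz
    exact Nat.not_even_iff_odd.2 hodd hxz
  · obtain ⟨k, hk⟩ := hyz
    rcases le_or_gt 2 y with hy | hy
    · refine hsplit 2 0 ?_ (by decide) (by decide) rfl hy (Nat.zero_le _) (by omega)
      rw [triple_add]; congr 1 <;> omega
    · refine hsplit 0 2 ?_ (by decide) (by decide) rfl (Nat.zero_le _) (by omega) (by omega)
      rw [triple_add]; congr 1 <;> omega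

variable {k m : ℕ} {f : Multiset (Multiset (DihedralGroup n))}

theorem exists_odd_of_odd_sum {f : Multiset (Multiset (DihedralGroup n))}
    (h : Odd (numX f.sum + numZ f.sum)) : ∃ U ∈ f, Odd (numX U + numZ U) := by
  by_contra hcon
  push Not at hcon
  refine Nat.not_even_iff_odd.2 h ?_
  induction f using Multiset.induction_on with
  | empty => simp
  | cons U f ih =>
    have h1 := Nat.not_odd_iff_even.1 (hcon U (Multiset.mem_cons_self _ _))
    have h2 : Even (numX f.sum + numZ f.sum) := by
      by_contra h2
      exact h2 (ih (Nat.not_even_iff_odd.1 h2) fun V hV => hcon V (Multiset.mem_cons_of_mem hV))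
    rw [Multiset.sum_cons, map_add, map_add, add_add_add_comm]
    exact h1.add h2

theorem IsFactorization.le_of_mem {G : Type*} [Group G] {A U : Multiset G}
    {f : Multiset (Multiset G)} (h : IsFactorization A f) (hU : U ∈ f) : U ≤ A :=
  h.2 ▸ Multiset.le_sum_of_mem hU

theorem card_eq_two_of_odd_mem (hn : 3 ≤ n) (hkm : k + m = 2 * n)
    (hf : IsFactorization (triple n k m m) f) (hodd : ∃ U ∈ f, Odd (numX U + numZ U)) :
    f.card = 2 ∧ ∀ U ∈ f, Odd (numX U + numZ U) := by
  have hbound : ∀ U ∈ f, Odd (numX U + numZ U) → n ≤ numX U + min (numY U) (numZ U) := by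
    intro U hU ho
    refine le_of_isProductOne_triple hn ?_ ho
    rw [← eq_triple_of_le hn (IsFactorization.le_of_mem hf hU)]
    exact (hf.1 U hU).isProductOne
  have hx := congrArg numX hf.2
  have hy := congrArg numY hf.2
  have hz := congrArg numZ hf.2
  rw [numX_triple] at hx
  rw [numY_triple hn] at hy
  rw [numZ_triple hn] at hz
  obtain ⟨U, hU, hUo⟩ := hodd
  have hUb := hbound U hU hUo
  obtain ⟨f, rfl⟩ := Multiset.exists_cons_of_mem hU
  rw [Multiset.sum_cons, map_add] at hx hy hz
  obtain ⟨V, hV, hVo⟩ := exists_odd_of_odd_sum (f := f) (by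
    obtain ⟨c, hc⟩ := hUo
    exact ⟨n - 1 - c, by omega⟩)
  have hVb := hbound V (Multiset.mem_cons_of_mem hV) hVo
  obtain ⟨f, rfl⟩ := Multiset.exists_cons_of_mem hV
  rw [Multiset.sum_cons, map_add] at hx hy hz
  have hle : f.sum ≤ triple n k m m := by
    rw [← hf.2, Multiset.sum_cons, Multiset.sum_cons]
    exact (Multiset.le_add_left _ _).trans (Multiset.le_add_left _ _)
  have hzero : f.sum = 0 := by
    rw [eq_triple_of_le hn hle, show numX f.sum = 0 by omega, show numY f.sum = 0 by omega,
      show numZ f.sum = 0 by omega]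
    simp [triple]
  have hf0 : f = 0 := by
    refine Multiset.eq_zero_of_forall_notMem fun W hW => ?_
    have h1 := Multiset.le_sum_of_mem hW
    rw [hzero, Multiset.le_zero] at h1
    exact (hf.1 W (by simp [hW])).1 h1
  subst hf0
  refine ⟨by simp, fun W hW => ?_⟩
  simp only [Multiset.mem_cons, Multiset.notMem_zero, or_false] at hW
  rcases hW with rfl | rfl <;> assumption

theorem card_eq_of_forall_even (hn : 3 ≤ n) (hodd : Odd n) (hk : k < 2 * n)
    (hf : IsFactorization (triple n k m m) f) (heven : ∀ U ∈ f, Even (numX U + numZ U)) :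
    f.card = m := by
  have htwo : ∀ U ∈ f, numY U + numZ U = 2 := by
    intro U hU
    have hUle := IsFactorization.le_of_mem hf hU
    have heq := eq_triple_of_le hn hUle
    have hX : numX U ≤ k := by
      rw [← numX_triple (n := n) k m m]
      exact Multiset.count_le_of_le _ hUle
    exact eq_two_of_isAtomSeq_triple hodd (heq ▸ hf.1 U hU) (by omega) (heven U hU)
  have hsum : (numY + numZ : Multiset (DihedralGroup n) →+ ℕ) f.sum = 2 * f.card := by
    rw [map_multiset_sum, Multiset.map_congr rfl fun U hU =>
      (AddMonoidHom.add_apply numY numZ U).trans (htwo U hU)]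
    simp [mul_comm]
  rw [hf.2, AddMonoidHom.add_apply, numY_triple hn, numZ_triple hn] at hsum
  omega

theorem card_eq_two_or (hn : 3 ≤ n) (hodd : Odd n) (hkm : k + m = 2 * n) (hm : 0 < m)
    (hf : IsFactorization (triple n k m m) f) : f.card = 2 ∨ f.card = m := by
  by_cases h : ∃ U ∈ f, Odd (numX U + numZ U)
  · exact Or.inl (card_eq_two_of_odd_mem hn hkm hf h).1
  · push Not at h
    exact Or.inr (card_eq_of_forall_even hn hodd (by omega) hf fun U hU =>
      Nat.not_odd_iff_even.1 (h U hU))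

theorem isProductOne_triple_of_add_eq {x y : ℕ} (hxy : x + y = n) (hy : 0 < y) :
    IsProductOne (triple n x y y) := by
  refine Balanced.isProductOne ⟨triple n x 0 y, triple n 0 y 0, ?_, ?_, ?_⟩
    (by rw [nref_triple]; omega)
  · rw [triple_add]; simp
  · rw [nref_triple, nref_triple]; omega
  · rw [idxSum_triple, idxSum_triple, ← Nat.cast_add, hxy]; simp

theorem exists_factorization_card_two (hn : 3 ≤ n) (hodd : Odd n) (hkm : k + m = 2 * n)
    (hm : 2 ≤ m) : ∃ f, IsFactorization (triple n k m m) f ∧ f.card = 2 := by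
  obtain ⟨f, hf⟩ := (isProductOne_triple_of_add_eq (n := n) (x := k / 2) (y := n - k / 2)
    (by omega) (by omega)).exists_atoms
  obtain ⟨g, hg⟩ := (isProductOne_triple_of_add_eq (n := n) (x := k - k / 2)
    (y := n - (k - k / 2)) (by omega) (by omega)).exists_atoms
  obtain ⟨U, hU, hUo⟩ := exists_odd_of_odd_sum (f := f) (by
    rw [hf.2, numX_triple, numZ_triple hn, show k / 2 + (n - k / 2) = n by omega]
    exact hodd)
  have hfg := IsFactorization.add hf hg
  rw [triple_add, show k / 2 + (k - k / 2) = k by omega,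
    show n - k / 2 + (n - (k - k / 2)) = m by omega] at hfg
  exact ⟨_, hfg, (card_eq_two_of_odd_mem hn hkm hfg ⟨U, Multiset.mem_add.2 (Or.inl hU), hUo⟩).1⟩

theorem exists_factorization_card_eq (hn : 3 ≤ n) (hodd : Odd n) (hkm : k + m = 2 * n)
    (hm : 2 ≤ m) : ∃ f, IsFactorization (triple n k m m) f ∧ f.card = m := by
  obtain ⟨f, hf⟩ := (isProductOne_triple (n := n) (x := 0) (y := 2) (z := 0) (by simp) (by simp)
    (by omega)).exists_atoms
  obtain ⟨g, hg⟩ := (isProductOne_triple (n := n) (x := k) (y := m - 2) (z := m)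
    ⟨n, by omega⟩ ⟨m - 1, by omega⟩ (by omega)).exists_atoms
  have hfg := IsFactorization.add hf hg
  rw [triple_add, zero_add, zero_add, show 2 + (m - 2) = m by omega] at hfg
  refine ⟨_, hfg, ?_⟩
  by_cases h : ∃ U ∈ f + g, Odd (numX U + numZ U)
  · exfalso
    obtain ⟨-, hall⟩ := card_eq_two_of_odd_mem hn hkm hfg h
    obtain ⟨U, hU⟩ := Multiset.exists_mem_of_ne_zero (s := f) (by
      rintro rfl
      have := congrArg nref hf.2
      rw [nref_triple] at this
      simp at this)
    have hUle : U ≤ triple n 0 2 0 := IsFactorization.le_of_mem hf hU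
    have h1 : numX U ≤ 0 := by
      rw [← numX_triple (n := n) 0 2 0]
      exact Multiset.count_le_of_le _ hUle
    have h2 : numZ U ≤ 0 := by
      rw [← numZ_triple (n := n) hn 0 2 0]
      exact Multiset.count_le_of_le _ hUle
    obtain ⟨c, hc⟩ := hall U (Multiset.mem_add.2 (Or.inl hU))
    omega
  · push Not at h
    exact card_eq_of_forall_even hn hodd (by omega) hfg fun U hU =>
      Nat.not_odd_iff_even.1 (h U hU)

end Family

end ProductOne

open ProductOne in
/-- Let `G` be a dihedral group of order `2n`, `n ≥ 3` odd. Then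
`Δ(G) = [1, 2n-2]`. -/
theorem delta_dihedral_eq_interval (n : ℕ) (hn : 3 ≤ n) (hodd : Odd n) :
    Delta (DihedralGroup n) = Set.Icc 1 (2 * n - 2) := by
  have : NeZero n := ⟨by omega⟩
  ext d
  constructor
  · rintro ⟨A, -, -, hd, a, ha, hb, hgap⟩
    obtain ⟨f, hfc, hf⟩ := mem_lengthsOn_univ.1 ha
    obtain ⟨g, hgc, hg⟩ := mem_lengthsOn_univ.1 hb
    have := gap_le hn hodd A a (a + d) (by omega) ⟨f, hf, hfc.le⟩ ⟨g, hg, hgc.ge⟩ fun h hh => by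
      have := hgap h.card (mem_lengthsOn_univ.2 ⟨h, rfl, hh⟩)
      omega
    exact ⟨hd, by omega⟩
  · rintro ⟨hd1, hd2⟩
    have hkm : 2 * n - 2 - d + (d + 2) = 2 * n := by omega
    obtain ⟨f, hf, hfc⟩ := exists_factorization_card_two hn hodd hkm (by omega)
    obtain ⟨g, hg, hgc⟩ := exists_factorization_card_eq hn hodd hkm (by omega)
    refine ⟨triple n (2 * n - 2 - d) (d + 2) (d + 2), fun _ _ => Set.mem_univ _, hf.isProductOne,
      hd1, 2, mem_lengthsOn_univ.2 ⟨f, hfc, hf⟩, mem_lengthsOn_univ.2 ⟨g, by omega, hg⟩, ?_⟩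
    intro b hb
    obtain ⟨h, rfl, hh⟩ := mem_lengthsOn_univ.1 hb
    have := card_eq_two_or hn hodd hkm (by omega) hh
    omega
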